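/- Let Ω be a rational convex domain and k ∈ ℤ≥0. Then min{ℓ_Ω(∂Λ) : Λ a competitor convex lattice domain with L_Λ = k+1} = inf{ℓ_Ω(∂Ξ) : Ξ ⊆ ℝ² a nonempty (possibly degenerate) compact convex polygon, each of whose edges is parallel to an edge of Ω (a degenerate Ξ being a point, or a segment parallel to an edge of Ω), with #(Ξ ∩ ℤ²) ≥ k+1}. (This is the combinatorial content of the identity c_k(X_Ω) = min{D·D_Ω : h⁰(Y_{Σ(Ω)}, D) ≥ k+1} over nef ℝ-divisors D on the toric variety of the inner normal fan of Ω, since such divisors correspond exactly to polygons with edges parallel to those of Ω.) -/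

import Mathlib

open scoped BigOperators Pointwise

noncomputable section

/-- Planar cross product `det(v,p) = v₁p₂ − v₂p₁`. -/
def det2 (v p : ℝ × ℝ) : ℝ := v.1 * p.2 - v.2 * p.1

/-- The `Ω`-length of a vector `v`: `max_{p ∈ Ω} det(v,p)`. -/
def omegaLen (Ω : Set (ℝ × ℝ)) (v : ℝ × ℝ) : ℝ := sSup (det2 v '' Ω)

/-- A (possibly degenerate) compact convex polygon with vertices listed in
clockwise order: a cyclic (period `n`) list of pairwise distinct vertices such
that the polygon (the convex hull of the vertices) lies in the right
half-plane of every directed edge. -/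
structure ClockPolygon where
  n : ℕ
  npos : 0 < n
  verts : ℕ → ℝ × ℝ
  periodic : ∀ i, verts (i + n) = verts i
  inj : ∀ i j, i < n → j < n → verts i = verts j → i = j
  clockwise : ∀ i, ∀ q ∈ convexHull ℝ (Set.range verts),
      det2 (verts (i + 1) - verts i) (q - verts i) ≤ 0

/-- The underlying point set of a polygon. -/
def ClockPolygon.body (P : ClockPolygon) : Set (ℝ × ℝ) :=
  convexHull ℝ (Set.range P.verts)

/-- The `Ω`-perimeter `ℓ_Ω(∂Λ)`: the sum of the `Ω`-lengths of the edge
vectors of `Λ`. -/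
def omegaPerim (Ω : Set (ℝ × ℝ)) (P : ClockPolygon) : ℝ :=
  ∑ i ∈ Finset.range P.n, omegaLen Ω (P.verts (i + 1) - P.verts i)

/-- Lattice points of the plane. -/
def IsLatticePt (p : ℝ × ℝ) : Prop := (∃ m : ℤ, p.1 = m) ∧ (∃ m : ℤ, p.2 = m)

/-- Rational points of the plane. -/
def IsRationalPt (p : ℝ × ℝ) : Prop := (∃ q : ℚ, p.1 = q) ∧ (∃ q : ℚ, p.2 = q)

/-- The number of lattice points in a set. -/
def latticeCount (S : Set (ℝ × ℝ)) : ℕ := {p ∈ S | IsLatticePt p}.ncard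

/-- Competitor convex lattice domains: convex hulls of finite nonempty sets of
lattice points in `ℝ≥0²`, containing the origin and closed under taking
coordinate rectangles. -/
def IsCompetitor (P : ClockPolygon) : Prop :=
  (∀ i, IsLatticePt (P.verts i)) ∧
  (∀ i, 0 ≤ (P.verts i).1 ∧ 0 ≤ (P.verts i).2) ∧
  (((0 : ℝ), (0 : ℝ)) ∈ P.body) ∧
  ∀ q ∈ P.body, Set.Icc (0 : ℝ) q.1 ×ˢ Set.Icc (0 : ℝ) q.2 ⊆ P.body

/-- ECH capacities of `X_Ω`, via Cristofaro-Gardiner's combinatorial formula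
(taken as a definition). -/
def echCap (Ω : Set (ℝ × ℝ)) (k : ℕ) : ℝ :=
  sInf { r | ∃ P : ClockPolygon, IsCompetitor P ∧
      latticeCount P.body = k + 1 ∧ omegaPerim Ω P = r }

/-- The cap function `cap_{X_Ω}(r) = #{k : c_k(X_Ω) ≤ r}`. -/
def capFn (Ω : Set (ℝ × ℝ)) (r : ℝ) : ℕ := {k : ℕ | echCap Ω k ≤ r}.ncard

/-- A convex domain: a convex polygon in `ℝ≥0²` with nonempty interior,
containing the origin and closed under taking coordinate rectangles. -/
structure ConvexDomain where
  P : ClockPolygon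
  int_nonempty : (interior P.body).Nonempty
  nonneg : ∀ q ∈ P.body, 0 ≤ q.1 ∧ 0 ≤ q.2
  zero_mem : (((0 : ℝ), (0 : ℝ)) ∈ P.body)
  rect : ∀ q ∈ P.body, Set.Icc (0 : ℝ) q.1 ×ˢ Set.Icc (0 : ℝ) q.2 ⊆ P.body

def ConvexDomain.body (Ω : ConvexDomain) : Set (ℝ × ℝ) := Ω.P.body

/-- A convex lattice domain: all vertices are lattice points. -/
def ConvexDomain.IsLattice (Ω : ConvexDomain) : Prop :=
  ∀ i, IsLatticePt (Ω.P.verts i)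

/-- A rational convex domain: all vertices are rational points. -/
def ConvexDomain.IsRational (Ω : ConvexDomain) : Prop :=
  ∀ i, IsRationalPt (Ω.P.verts i)

/-- `X_Ω` is tightly constrained with lower bound `r₀` if every integer
`r ≥ r₀` is a value `c_k(X_Ω)`. -/
def TightlyConstrained (Ω : ConvexDomain) (r₀ : ℕ) : Prop :=
  ∀ r : ℕ, r₀ ≤ r → ∃ k : ℕ, echCap Ω.body k = r

/-- Every (nonzero) edge of `Q` is parallel to an edge of `P`. -/
def EdgesParallel (Q P : ClockPolygon) : Prop :=
  ∀ i < Q.n, Q.verts (i + 1) - Q.verts i ≠ 0 →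
    ∃ j < P.n, ∃ t : ℝ, t ≠ 0 ∧
      Q.verts (i + 1) - Q.verts i = t • (P.verts (j + 1) - P.verts j)

/-- Euclidean inner product on the plane. -/
def dot2 (u p : ℝ × ℝ) : ℝ := u.1 * p.1 + u.2 * p.2

/-- The dual-norm value `max_{p ∈ K} u·p` (the support function of `K`). -/
def dualLen (K : Set (ℝ × ℝ)) (u : ℝ × ℝ) : ℝ := sSup (dot2 u '' K)

/-- The pseudonorm length `ℓ'_Ω(∂Λ)` with respect to a translated body `K`. -/
def dualPerim (K : Set (ℝ × ℝ)) (P : ClockPolygon) : ℝ :=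
  ∑ i ∈ Finset.range P.n, dualLen K (P.verts (i + 1) - P.verts i)



def Lpos (v : ℝ × ℝ) : Prop := 0 < v.1 ∨ (v.1 = 0 ∧ 0 < v.2)
def Lnn (v : ℝ × ℝ) : Prop := 0 < v.1 ∨ (v.1 = 0 ∧ 0 ≤ v.2)

lemma Lpos.nn {v : ℝ × ℝ} (h : Lpos v) : Lnn v := by
  rcases h with h | ⟨h, h'⟩
  · exact Or.inl h
  · exact Or.inr ⟨h, h'.le⟩

lemma Lnn_zero : Lnn (0 : ℝ × ℝ) := Or.inr ⟨rfl, le_rfl⟩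

lemma Lpos.add_nn {v w : ℝ × ℝ} (h : Lpos v) (h' : Lnn w) : Lpos (v + w) := by
  unfold Lpos Lnn at *
  simp only [Prod.fst_add, Prod.snd_add]
  rcases h with h | ⟨h, h2⟩ <;> rcases h' with h' | ⟨h', h3⟩
  · left; linarith
  · left; linarith
  · left; linarith
  · right; constructor <;> linarith

lemma Lnn.add {v w : ℝ × ℝ} (h : Lnn v) (h' : Lnn w) : Lnn (v + w) := by
  unfold Lnn at *
  simp only [Prod.fst_add, Prod.snd_add]
  rcases h with h | ⟨h, h2⟩ <;> rcases h' with h' | ⟨h', h3⟩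
  · left; linarith
  · left; linarith
  · left; linarith
  · right; constructor <;> linarith

lemma Lnn.smul {v : ℝ × ℝ} {t : ℝ} (ht : 0 ≤ t) (h : Lnn v) : Lnn (t • v) := by
  unfold Lnn at *
  simp only [Prod.smul_fst, Prod.smul_snd, smul_eq_mul]
  rcases ht.eq_or_lt with ht | ht
  · subst ht; simp
  · rcases h with h | ⟨h, h2⟩
    · left; positivity
    · right; rw [h]; exact ⟨by ring, by positivity⟩

lemma Lpos.smul {v : ℝ × ℝ} {t : ℝ} (ht : 0 < t) (h : Lpos v) : Lpos (t • v) := by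
  unfold Lpos at *
  simp only [Prod.smul_fst, Prod.smul_snd, smul_eq_mul]
  rcases h with h | ⟨h, h2⟩
  · left; positivity
  · right; rw [h]; exact ⟨by ring, by positivity⟩

lemma not_Lpos_zero : ¬ Lpos (0 : ℝ × ℝ) := by
  rintro (h | ⟨_, h⟩) <;> simp at h

lemma Lpos.ne {v : ℝ × ℝ} (h : Lpos v) : v ≠ 0 := by
  rintro rfl; exact not_Lpos_zero h

lemma not_Lnn {v : ℝ × ℝ} : ¬ Lnn v ↔ Lpos (-v) := by
  unfold Lnn Lpos
  simp only [Prod.fst_neg, Prod.snd_neg, not_or, not_and, not_le, not_lt]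
  constructor
  · rintro ⟨h1, h2⟩
    rcases h1.lt_or_eq with h | h
    · left; linarith
    · right; exact ⟨by linarith, by linarith [h2 h]⟩
  · rintro (h | ⟨h1, h2⟩)
    · exact ⟨by linarith, fun h' => by linarith⟩
    · exact ⟨by linarith, fun h' => by linarith⟩

lemma not_Lpos {v : ℝ × ℝ} : ¬ Lpos v ↔ Lnn (-v) := by
  have := @not_Lnn (-v)
  rw [neg_neg] at this
  rw [← this, not_not]

lemma Lpos.not_nn_neg {v : ℝ × ℝ} (h : Lpos v) : ¬ Lnn (-v) := by
  rw [not_Lnn, neg_neg]; exact h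

lemma Lnn.pos_of_ne {v : ℝ × ℝ} (h : Lnn v) (h0 : v ≠ 0) : Lpos v := by
  rcases h with h | ⟨h, h2⟩
  · exact Or.inl h
  · refine Or.inr ⟨h, lt_of_le_of_ne h2 fun h3 => h0 (Prod.ext h h3.symm)⟩

lemma Lnn.eq_zero {v : ℝ × ℝ} (h : Lnn v) (h' : Lnn (-v)) : v = 0 := by
  by_contra h0
  exact (h.pos_of_ne h0).not_nn_neg h'

lemma det2_tr {a b c : ℝ × ℝ} (ha : Lnn a) (hb : Lpos b) (hc : Lnn c)
    (h1 : 0 ≤ det2 b a) (h2 : 0 ≤ det2 c b) : 0 ≤ det2 c a := by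
  by_contra hlt
  push Not at hlt
  have hac : 0 < -det2 c a := by linarith
  have key : (-det2 c a) • b + (det2 b a • c + det2 c b • a) = 0 := by
    ext <;> simp [det2] <;> ring
  have := (hb.smul hac).add_nn ((hc.smul h1).add (ha.smul h2))
  rw [key] at this
  exact not_Lpos_zero this

structure UChain (p : ℕ → ℝ × ℝ) (m : ℕ) (X : Set (ℝ × ℝ)) : Prop where
  mono : ∀ i < m, Lpos (p (i + 1) - p i)
  mem : ∀ i ≤ m, p i ∈ X
  lo : ∀ x ∈ X, Lnn (x - p 0)
  hi : ∀ x ∈ X, Lnn (p m - x)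
  right : ∀ i < m, ∀ x ∈ X, det2 (p (i + 1) - p i) (x - p i) ≤ 0

lemma UChain.lt {p : ℕ → ℝ × ℝ} {m : ℕ} {X : Set (ℝ × ℝ)} (h : UChain p m X) {i j : ℕ}
    (hij : i < j) (hj : j ≤ m) : Lpos (p j - p i) := by
  induction j, hij using Nat.le_induction with
  | base => exact h.mono i (by omega)
  | succ j hij ih =>
    have h1 := ih (by omega)
    have h2 := h.mono j (by omega)
    have := h1.add_nn h2.nn
    simpa using this

lemma sum_max_aux (g : ℕ → ℝ) (c m : ℕ) (hc : c ≤ m) (h1 : ∀ i < c, 0 ≤ g (i + 1) - g i)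
    (h2 : ∀ i, c ≤ i → i < m → g (i + 1) - g i ≤ 0) :
    ∑ i ∈ Finset.range m, max (g (i + 1) - g i) 0 = g c - g 0 := by
  induction m, hc using Nat.le_induction with
  | base =>
    rw [← Finset.sum_range_sub]
    exact Finset.sum_congr rfl fun i hi => max_eq_left (h1 i (Finset.mem_range.1 hi))
  | succ m hm ih =>
    rw [Finset.sum_range_succ, ih (fun i hi hi' => h2 i hi (by omega)),
      max_eq_right (h2 m hm (by omega)), add_zero]

lemma det2_sub_right (u x y : ℝ × ℝ) : det2 u (x - y) = det2 u x - det2 u y := by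
  simp [det2]; ring
lemma det2_sub_left (u x y : ℝ × ℝ) : det2 (x - y) u = det2 x u - det2 y u := by
  simp [det2]; ring
lemma det2_add_right (u x y : ℝ × ℝ) : det2 u (x + y) = det2 u x + det2 u y := by
  simp [det2]; ring
lemma det2_add_left (u x y : ℝ × ℝ) : det2 (x + y) u = det2 x u + det2 y u := by
  simp [det2]; ring
lemma det2_smul_right (t : ℝ) (u x : ℝ × ℝ) : det2 u (t • x) = t * det2 u x := by
  simp [det2]; ring
lemma det2_smul_left (t : ℝ) (u x : ℝ × ℝ) : det2 (t • u) x = t * det2 u x := by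
  simp [det2]; ring
lemma det2_neg_neg (u x : ℝ × ℝ) : det2 (-u) (-x) = det2 u x := by
  simp [det2]
lemma det2_neg_left (u x : ℝ × ℝ) : det2 (-u) x = -det2 u x := by
  simp [det2]; ring
lemma det2_neg_right (u x : ℝ × ℝ) : det2 u (-x) = -det2 u x := by
  simp [det2]; ring
lemma det2_swap (u x : ℝ × ℝ) : det2 u x = -det2 x u := by
  simp [det2]; ring
lemma det2_self (u : ℝ × ℝ) : det2 u u = 0 := by
  simp [det2]; ring
lemma det2_zero_left (u : ℝ × ℝ) : det2 0 u = 0 := by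
  simp [det2]
lemma det2_zero_right (u : ℝ × ℝ) : det2 u 0 = 0 := by
  simp [det2]

lemma UChain.isGreatest {p : ℕ → ℝ × ℝ} {m : ℕ} {X : Set (ℝ × ℝ)} (h : UChain p m X)
    {u : ℝ × ℝ} (hu : Lnn u) :
    IsGreatest (det2 u '' X)
      (det2 u (p 0) + ∑ i ∈ Finset.range m, max (det2 u (p (i + 1) - p i)) 0) := by
  obtain ⟨c, hc, hmax⟩ := Finset.exists_max_image (Finset.range (m + 1)) (fun i => det2 u (p i))
    ⟨0, by simp⟩
  simp only [Finset.mem_range, Nat.lt_succ_iff] at hc hmax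
  have h1 : ∀ i < c, 0 ≤ det2 u (p (i + 1)) - det2 u (p i) := by
    intro i hi
    rw [← det2_sub_right]
    refine det2_tr (h.mono i (by omega)).nn (h.lt hi hc) hu ?_ ?_
    · have := h.right i (by omega) (p c) (h.mem c hc)
      rw [det2_swap] at this; linarith
    · rw [det2_sub_right]; linarith [hmax i (by omega)]
  have h2 : ∀ i, c ≤ i → i < m → det2 u (p (i + 1)) - det2 u (p i) ≤ 0 := by
    intro i hci hi
    rw [← det2_sub_right, det2_swap]
    have : 0 ≤ det2 (p (i + 1) - p i) u := by
      refine det2_tr hu (h.lt (show c < i + 1 by omega) (by omega)) (h.mono i hi).nn ?_ ?_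
      · rw [det2_swap, det2_sub_right]; linarith [hmax (i + 1) (by omega)]
      · have h3 := h.right i hi (p c) (h.mem c hc)
        have : p (i + 1) - p c = (p (i + 1) - p i) - (p c - p i) := by abel
        rw [this, det2_sub_right _ (p (i + 1) - p i), det2_self]; linarith
    linarith
  have hR : (det2 u (p 0) + ∑ i ∈ Finset.range m, max (det2 u (p (i + 1) - p i)) 0)
      = det2 u (p c) := by
    have := sum_max_aux (fun i => det2 u (p i)) c m hc h1 h2
    simp only [det2_sub_right]
    rw [this]; ring
  rw [hR]
  refine ⟨⟨p c, h.mem c hc, rfl⟩, ?_⟩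
  rintro _ ⟨x, hx, rfl⟩
  have hl : ∃ l ≤ m, Lnn (x - p l) ∧ (l < m → ¬ Lnn (x - p (l + 1))) := by
    by_contra hcon
    push Not at hcon
    have : ∀ l ≤ m, Lnn (x - p l) := by
      intro l
      induction l with
      | zero => intro _; exact h.lo x hx
      | succ l ih => intro hl; exact (hcon l (by omega) (ih (by omega))).2
    exact absurd (hcon m le_rfl (this m le_rfl)).1 (by omega)
  obtain ⟨l, hlm, hl1, hl2⟩ := hl
  rcases hlm.eq_or_lt with rfl | hlt
  · have : x - p l = 0 := hl1.eq_zero (by rw [neg_sub]; exact h.hi x hx)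
    rw [sub_eq_zero.1 this]
    exact hmax l hlm
  · have hl3 := hl2 hlt
    rw [not_Lnn, neg_sub] at hl3
    have hf := h.mono l hlt
    have hr := h.right l hlt x hx
    rcases le_total 0 (det2 u (p (l + 1) - p l)) with h0 | h0
    · have : 0 ≤ det2 u (p (l + 1) - x) := by
        refine det2_tr hl3.nn hf hu ?_ h0
        have : p (l + 1) - x = (p (l + 1) - p l) - (x - p l) := by abel
        rw [this, det2_sub_right _ (p (l + 1) - p l), det2_self]; linarith
      rw [det2_sub_right] at this
      linarith [hmax (l + 1) (by omega)]
    · have : 0 ≤ det2 (x - p l) u := by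
        refine det2_tr hu hf hl1 ?_ ?_
        · rw [det2_swap]; linarith
        · rw [det2_swap]; linarith
      rw [det2_swap, det2_sub_right] at this
      linarith [hmax l (by omega)]

structure Cyc (p : ℕ → ℝ × ℝ) (m r : ℕ) (X : Set (ℝ × ℝ)) : Prop where
  up : UChain p m X
  dn : UChain (fun i => -p (m + i)) r {x | -x ∈ X}
  cl : p (m + r) = p 0

lemma Cyc.len_up {p : ℕ → ℝ × ℝ} {m r : ℕ} {X : Set (ℝ × ℝ)} (h : Cyc p m r X)
    {u : ℝ × ℝ} (hu : Lnn u) : omegaLen X u =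
      det2 u (p 0) + ∑ i ∈ Finset.range m, max (det2 u (p (i + 1) - p i)) 0 :=
  (h.up.isGreatest hu).csSup_eq

lemma Cyc.len_dn {p : ℕ → ℝ × ℝ} {m r : ℕ} {X : Set (ℝ × ℝ)} (h : Cyc p m r X)
    {u : ℝ × ℝ} (hu : Lnn (-u)) : omegaLen X u =
      det2 u (p m) + ∑ i ∈ Finset.range r, max (det2 u (p (m + i + 1) - p (m + i))) 0 := by
  have h1 := (h.dn.isGreatest hu).csSup_eq
  have h2 : det2 (-u) '' {x | -x ∈ X} = det2 u '' X := by
    ext y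
    constructor
    · rintro ⟨x, hx, rfl⟩
      exact ⟨-x, hx, by simp [det2]⟩
    · rintro ⟨x, hx, rfl⟩
      exact ⟨-x, by simpa using hx, by simp [det2]⟩
  rw [h2] at h1
  unfold omegaLen
  rw [h1]
  congr 1
  · simp [det2]
  · refine Finset.sum_congr rfl fun i _ => ?_
    congr 1
    simp [det2, add_assoc]; ring

lemma sum_det2_left (e : ℕ → ℝ × ℝ) (x : ℝ × ℝ) (m : ℕ) :
    ∑ i ∈ Finset.range m, det2 (e (i + 1) - e i) x = det2 (e m - e 0) x := by
  simp only [det2_sub_left]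
  rw [Finset.sum_range_sub (fun i => det2 (e i) x)]

lemma sum_det2_right (e : ℕ → ℝ × ℝ) (x : ℝ × ℝ) (m : ℕ) :
    ∑ i ∈ Finset.range m, det2 x (e (i + 1) - e i) = det2 x (e m - e 0) := by
  simp only [det2_sub_right]
  rw [Finset.sum_range_sub (fun i => det2 x (e i))]

lemma sum_max_symm (p q : ℕ → ℝ × ℝ) (m m' : ℕ) :
    ∑ j ∈ Finset.range m', ∑ i ∈ Finset.range m,
        max (det2 (q (j + 1) - q j) (p (i + 1) - p i)) 0 =
    det2 (q m' - q 0) (p m - p 0) + ∑ i ∈ Finset.range m, ∑ j ∈ Finset.range m',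
        max (det2 (p (i + 1) - p i) (q (j + 1) - q j)) 0 := by
  rw [← sum_det2_left, Finset.sum_comm (s := Finset.range m), ← Finset.sum_add_distrib]
  refine Finset.sum_congr rfl fun j _ => ?_
  rw [← sum_det2_right, ← Finset.sum_add_distrib]
  refine Finset.sum_congr rfl fun i _ => ?_
  rw [det2_swap (p (i + 1) - p i)]
  generalize det2 (q (j + 1) - q j) (p (i + 1) - p i) = t
  rcases le_total 0 t with h | h
  · rw [max_eq_left h, max_eq_right (by linarith)]; ring
  · rw [max_eq_right h, max_eq_left (by linarith)]; ring

lemma Cyc.sum_len {p q : ℕ → ℝ × ℝ} {m r m' r' : ℕ} {X Y : Set (ℝ × ℝ)} (h : Cyc p m r X)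
    (h' : Cyc q m' r' Y) : ∑ j ∈ Finset.range (m' + r'), omegaLen X (q (j + 1) - q j) =
      det2 (q m' - q 0) (p 0 - p m)
      + ∑ j ∈ Finset.range m', ∑ i ∈ Finset.range m,
        max (det2 (q (j + 1) - q j) (p (i + 1) - p i)) 0
      + ∑ j ∈ Finset.range r', ∑ i ∈ Finset.range r,
        max (det2 (q (m' + j + 1) - q (m' + j)) (p (m + i + 1) - p (m + i))) 0 := by
  rw [Finset.sum_range_add]
  have e1 : ∑ j ∈ Finset.range m', omegaLen X (q (j + 1) - q j) =
      det2 (q m' - q 0) (p 0) + ∑ j ∈ Finset.range m', ∑ i ∈ Finset.range m,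
        max (det2 (q (j + 1) - q j) (p (i + 1) - p i)) 0 := by
    rw [← sum_det2_left, ← Finset.sum_add_distrib]
    exact Finset.sum_congr rfl fun j hj => h.len_up (h'.up.mono j (Finset.mem_range.1 hj)).nn
  have e2 : ∑ j ∈ Finset.range r', omegaLen X (q (m' + j + 1) - q (m' + j)) =
      det2 (q 0 - q m') (p m) + ∑ j ∈ Finset.range r', ∑ i ∈ Finset.range r,
        max (det2 (q (m' + j + 1) - q (m' + j)) (p (m + i + 1) - p (m + i))) 0 := by
    have := sum_det2_left (fun j => q (m' + j)) (p m) r'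
    simp only [h'.cl, add_zero] at this
    rw [← this, ← Finset.sum_add_distrib]
    refine Finset.sum_congr rfl fun j hj => h.len_dn ?_
    have := (h'.dn.mono j (Finset.mem_range.1 hj)).nn
    convert this using 1
    simp only [add_assoc]; abel
  rw [e1, e2]
  simp only [det2_sub_left, det2_sub_right]; ring

lemma Cyc.symm_len {p q : ℕ → ℝ × ℝ} {m r m' r' : ℕ} {X Y : Set (ℝ × ℝ)} (h : Cyc p m r X)
    (h' : Cyc q m' r' Y) : ∑ j ∈ Finset.range (m' + r'), omegaLen X (q (j + 1) - q j) =
      ∑ j ∈ Finset.range (m + r), omegaLen Y (p (j + 1) - p j) := by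
  rw [h.sum_len h', h'.sum_len h, sum_max_symm p q]
  have := sum_max_symm (fun i => p (m + i)) (fun i => q (m' + i)) r r'
  simp only [h.cl, h'.cl, add_zero, ← add_assoc] at this
  rw [this]
  simp only [det2_sub_left, det2_sub_right]
  rw [det2_swap (p m) (q 0), det2_swap (p m) (q m'), det2_swap (p 0) (q 0),
    det2_swap (p 0) (q m')]
  ring


lemma toLex_lt_iff (p q : ℝ × ℝ) : toLex p < toLex q ↔ Lpos (q - p) := by
  rw [Prod.Lex.toLex_lt_toLex]
  unfold Lpos
  simp only [Prod.fst_sub, Prod.snd_sub, sub_pos, sub_eq_zero]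
  constructor <;> rintro (h | ⟨h, h'⟩)
  · exact Or.inl h
  · exact Or.inr ⟨h.symm, h'⟩
  · exact Or.inl h
  · exact Or.inr ⟨h.symm, h'⟩

lemma toLex_le_iff (p q : ℝ × ℝ) : toLex p ≤ toLex q ↔ Lnn (q - p) := by
  rw [← not_lt, toLex_lt_iff, not_Lpos, neg_sub]

lemma exists_lex_min (S : Finset (ℝ × ℝ)) (hS : S.Nonempty) :
    ∃ a ∈ S, ∀ x ∈ S, Lnn (x - a) := by
  obtain ⟨a, ha, h⟩ := Finset.exists_min_image S toLex hS
  exact ⟨a, ha, fun x hx => (toLex_le_iff _ _).1 (h x hx)⟩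

lemma exists_lex_max (S : Finset (ℝ × ℝ)) (hS : S.Nonempty) :
    ∃ a ∈ S, ∀ x ∈ S, Lnn (a - x) := by
  obtain ⟨a, ha, h⟩ := Finset.exists_max_image S toLex hS
  exact ⟨a, ha, fun x hx => (toLex_le_iff _ _).1 (h x hx)⟩

lemma lex_enum (U : Finset (ℝ × ℝ)) (hU : U.Nonempty) :
    ∃ (m : ℕ) (u : ℕ → ℝ × ℝ), (∀ i j, i < j → j ≤ m → Lpos (u j - u i)) ∧
      (∀ i ≤ m, u i ∈ U) ∧ (∀ x ∈ U, ∃ i ≤ m, u i = x) := by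
  classical
  induction U using Finset.induction_on_max_value (f := (toLex : ℝ × ℝ → _)) with
  | empty => exact absurd hU (by simp)
  | insert a s ha hmax ih =>
    rcases s.eq_empty_or_nonempty with rfl | hs
    · refine ⟨0, fun _ => a, ?_, ?_, ?_⟩
      · intro i j h1 h2; omega
      · simp
      · simp
    · obtain ⟨m, u, h1, h2, h3⟩ := ih hs
      refine ⟨m + 1, fun i => if i ≤ m then u i else a, ?_, ?_, ?_⟩
      · intro i j hij hj
        have hi : i ≤ m := by omega
        simp only [hi, if_true]
        split_ifs with hjm
        · exact h1 i j hij hjm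
        · refine ((toLex_le_iff _ _).1 (hmax _ (h2 i hi))).pos_of_ne ?_
          intro h
          rw [sub_eq_zero] at h
          exact ha (h ▸ h2 i hi)
      · intro i _
        dsimp only
        split_ifs with h
        · exact Finset.mem_insert_of_mem (h2 i h)
        · exact Finset.mem_insert_self _ _
      · intro x hx
        rcases Finset.mem_insert.1 hx with rfl | hx
        · exact ⟨m + 1, le_rfl, by simp⟩
        · obtain ⟨i, hi, rfl⟩ := h3 x hx
          exact ⟨i, by omega, by simp [hi]⟩

lemma chainU (S : Finset (ℝ × ℝ)) (hS : S.Nonempty) :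
    ∃ (m : ℕ) (u : ℕ → ℝ × ℝ), UChain u m (S : Set (ℝ × ℝ)) ∧
      (∀ i, 0 < i → i < m → 0 < det2 (u m - u 0) (u i - u 0)) ∧
      (∀ d, Lpos d → ∃ i ≤ m, ∀ s ∈ S, det2 d s ≤ det2 d (u i)) := by
  classical
  set U := S.filter (fun p => ∀ s ∈ S, ∀ t ∈ S, Lpos (p - s) → Lpos (t - p) →
    0 < det2 (t - s) (p - s)) with hUdef
  have hU : ∀ p, p ∈ U ↔ p ∈ S ∧ ∀ s ∈ S, ∀ t ∈ S, Lpos (p - s) → Lpos (t - p) →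
    0 < det2 (t - s) (p - s) := fun p => by simp [hUdef]
  -- directional maxima
  have key : ∀ d, Lpos d → ∃ b ∈ U, ∀ s ∈ S, det2 d s ≤ det2 d b := by
    intro d hd
    obtain ⟨b0, hb0, hm0⟩ := Finset.exists_max_image S (det2 d) hS
    obtain ⟨b, hb, hm⟩ := exists_lex_max (S.filter (fun s => det2 d s = det2 d b0))
      ⟨b0, by simp [hb0]⟩
    simp only [Finset.mem_filter] at hb hm
    refine ⟨b, (hU b).2 ⟨hb.1, ?_⟩, fun s hs => hb.2 ▸ hm0 s hs⟩
    intro r hr t ht hrb hbt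
    have h1 : 0 ≤ det2 d (b - r) := by
      rw [det2_sub_right, hb.2]; linarith [hm0 r hr]
    have h2 : det2 d (t - b) < 0 := by
      rw [det2_sub_right, hb.2]
      rcases (hm0 t ht).lt_or_eq with h | h
      · linarith
      · have := hm t ⟨ht, h⟩
        rw [← neg_sub] at this
        exact absurd this hbt.not_nn_neg
    have e : det2 (t - r) (b - r) = det2 (t - b) (b - r) := by
      simp [det2]; ring
    rw [e]
    by_contra hcon
    push Not at hcon
    have h3 : 0 ≤ det2 (b - r) (t - b) := by rw [det2_swap]; linarith
    have := det2_tr hbt.nn hrb hd.nn h3 h1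
    linarith
  have exta : ∃ a ∈ U, ∀ x ∈ S, Lnn (x - a) := by
    obtain ⟨a, ha, h⟩ := exists_lex_min S hS
    refine ⟨a, (hU a).2 ⟨ha, ?_⟩, h⟩
    intro s hs t ht h1
    have := h s hs
    rw [← neg_sub] at this
    exact absurd this h1.not_nn_neg
  have extb : ∃ a ∈ U, ∀ x ∈ S, Lnn (a - x) := by
    obtain ⟨a, ha, h⟩ := exists_lex_max S hS
    refine ⟨a, (hU a).2 ⟨ha, ?_⟩, h⟩
    intro s hs t ht _ h1
    have := h t ht
    rw [← neg_sub] at this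
    exact absurd this h1.not_nn_neg
  obtain ⟨a, haU, ha⟩ := exta
  obtain ⟨b, hbU, hb⟩ := extb
  obtain ⟨m, u, h1, h2, h3⟩ := lex_enum U ⟨a, haU⟩
  have hUS : ∀ i ≤ m, u i ∈ S := fun i hi => ((hU _).1 (h2 i hi)).1
  have hu0 : u 0 = a := by
    obtain ⟨i, hi, hia⟩ := h3 a haU
    rcases Nat.eq_zero_or_pos i with rfl | hpos
    · exact hia
    · have := h1 0 i hpos hi
      rw [hia] at this
      have h' := ha (u 0) (hUS 0 (by omega))
      rw [← neg_sub] at h'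
      exact absurd h' this.not_nn_neg
  have hum : u m = b := by
    obtain ⟨i, hi, hia⟩ := h3 b hbU
    rcases hi.eq_or_lt with rfl | hpos
    · exact hia
    · have := h1 i m hpos le_rfl
      rw [hia] at this
      have h' := hb (u m) (hUS m (by omega))
      rw [← neg_sub] at h'
      exact absurd h' this.not_nn_neg
  refine ⟨m, u, ⟨fun i hi => h1 i (i + 1) (by omega) (by omega), fun i hi => hUS i hi,
    ?_, ?_, ?_⟩, ?_, ?_⟩
  · rw [hu0]; exact ha
  · rw [hum]; exact hb
  · intro i hi x hx
    by_contra hcon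
    push Not at hcon
    have hd := h1 i (i + 1) (by omega) (by omega)
    obtain ⟨s, hsU, hs⟩ := key _ hd
    have hDs : 0 < det2 (u (i + 1) - u i) (s - u i) := by
      have := hs x hx
      rw [det2_sub_right] at hcon ⊢
      linarith
    obtain ⟨j, hj, rfl⟩ := h3 s hsU
    rcases lt_trichotomy j i with h | rfl | h
    · have h4 := ((hU _).1 (h2 i (by omega))).2 (u j) (hUS j hj) (u (i + 1)) (hUS _ (by omega))
        (h1 j i h (by omega)) hd
      have e : det2 (u (i + 1) - u j) (u i - u j) = - det2 (u (i + 1) - u i) (u j - u i) := by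
        simp [det2]; ring
      linarith
    · rw [sub_self, det2_zero_right] at hDs; exact lt_irrefl _ hDs
    · rcases (Nat.succ_le_of_lt h).eq_or_lt with h | h
      · rw [← h, det2_self] at hDs
        exact lt_irrefl _ hDs
      · have h4 := ((hU _).1 (h2 (i + 1) (by omega))).2 (u i) (hUS i (by omega)) (u j) (hUS _ hj)
          hd (h1 _ _ h hj)
        rw [det2_swap] at h4
        linarith
  · intro i hi him
    exact ((hU _).1 (h2 i (by omega))).2 (u 0) (hUS 0 (by omega)) (u m) (hUS _ le_rfl)
      (h1 _ _ hi (by omega)) (h1 _ _ him le_rfl)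
  · intro d hd
    obtain ⟨c, hc, h⟩ := key d hd
    obtain ⟨i, hi, rfl⟩ := h3 c hc
    exact ⟨i, hi, h⟩


lemma convex_Lnn_sub (a : ℝ × ℝ) : Convex ℝ {x | Lnn (x - a)} := by
  intro x hx y hy s t hs ht hst
  have : s • x + t • y - a = s • (x - a) + t • (y - a) := by
    have : a = (s + t) • a := by rw [hst, one_smul]
    nth_rewrite 1 [this]
    simp only [smul_sub, add_smul]; abel
  simp only [Set.mem_ofPred_eq]
  rw [this]
  exact (Lnn.smul hs hx).add (Lnn.smul ht hy)

lemma convex_Lnn_sub' (a : ℝ × ℝ) : Convex ℝ {x | Lnn (a - x)} := by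
  intro x hx y hy s t hs ht hst
  have : a - (s • x + t • y) = s • (a - x) + t • (a - y) := by
    have : a = (s + t) • a := by rw [hst, one_smul]
    nth_rewrite 1 [this]
    simp only [smul_sub, add_smul]; abel
  simp only [Set.mem_ofPred_eq]
  rw [this]
  exact (Lnn.smul hs hx).add (Lnn.smul ht hy)

lemma convex_det_le (d : ℝ × ℝ) (c : ℝ) : Convex ℝ {x | det2 d x ≤ c} := by
  intro x hx y hy s t hs ht hst
  simp only [Set.mem_ofPred_eq] at *
  rw [det2_add_right, det2_smul_right, det2_smul_right]
  have : c = s * c + t * c := by rw [← add_mul, hst, one_mul]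
  rw [this]
  gcongr

lemma UChain.hull {p : ℕ → ℝ × ℝ} {m : ℕ} {X : Set (ℝ × ℝ)} (h : UChain p m X) :
    UChain p m (convexHull ℝ X) where
  mono := h.mono
  mem i hi := subset_convexHull ℝ X (h.mem i hi)
  lo x hx := convexHull_min (t := {x | Lnn (x - p 0)}) h.lo (convex_Lnn_sub _) hx
  hi x hx := convexHull_min (t := {x | Lnn (p m - x)}) h.hi (convex_Lnn_sub' _) hx
  right i hi x hx := by
    have := convexHull_min (t := {x | det2 (p (i + 1) - p i) x ≤ det2 (p (i + 1) - p i) (p i)})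
      (fun x hx => by
        have := h.right i hi x hx
        rw [det2_sub_right] at this
        simp only [Set.mem_ofPred_eq]; linarith) (convex_det_le _ _) hx
    simp only [Set.mem_ofPred_eq] at this
    rw [det2_sub_right]; linarith

lemma UChain.congr {p q : ℕ → ℝ × ℝ} {m : ℕ} {X : Set (ℝ × ℝ)} (h : UChain p m X)
    (hpq : ∀ i ≤ m, q i = p i) : UChain q m X where
  mono i hi := by rw [hpq i (by omega), hpq (i + 1) (by omega)]; exact h.mono i hi
  mem i hi := by rw [hpq i hi]; exact h.mem i hi
  lo := by rw [hpq 0 (by omega)]; exact h.lo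
  hi := by rw [hpq m le_rfl]; exact h.hi
  right i hi := by rw [hpq i (by omega), hpq (i + 1) (by omega)]; exact h.right i hi

def HasCyc (P : ClockPolygon) : Prop :=
  ∃ (p : ℕ → ℝ × ℝ) (m r : ℕ), Cyc p m r P.body ∧
    ∀ Y : Set (ℝ × ℝ), Y.Nonempty →
      omegaPerim Y P = ∑ i ∈ Finset.range (m + r), omegaLen Y (p (i + 1) - p i)

lemma omegaLen_zero {Y : Set (ℝ × ℝ)} (hY : Y.Nonempty) : omegaLen Y 0 = 0 := by
  unfold omegaLen
  have : det2 0 '' Y = {0} := by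
    ext y
    simp only [Set.mem_image, Set.mem_singleton_iff, det2_zero_left]
    constructor
    · rintro ⟨_, _, h⟩; exact h.symm
    · rintro rfl; exact ⟨hY.some, hY.some_mem, rfl⟩
  rw [this, csSup_singleton]

def ptPolygon (a : ℝ × ℝ) : ClockPolygon where
  n := 1
  npos := one_pos
  verts _ := a
  periodic _ := rfl
  inj i j hi hj _ := by omega
  clockwise i q _ := by rw [sub_self, det2_zero_left]

lemma linear_eq_det (f : (ℝ × ℝ) →L[ℝ] ℝ) (x : ℝ × ℝ) :
    f x = det2 (f (0, 1), - f (1, 0)) x := by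
  have : x = x.1 • ((1 : ℝ), (0 : ℝ)) + x.2 • ((0 : ℝ), (1 : ℝ)) := by
    ext <;> simp
  conv_lhs => rw [this]
  rw [map_add, map_smul, map_smul]
  simp [det2]; ring

lemma exists_polygon (S : Finset (ℝ × ℝ)) (hS : S.Nonempty) :
    ∃ P : ClockPolygon, P.body = convexHull ℝ (S : Set (ℝ × ℝ)) ∧ (∀ i, P.verts i ∈ S) ∧
      HasCyc P := by
  classical
  obtain ⟨m, u, hu, hu2, hu3⟩ := chainU S hS
  obtain ⟨r, v, hv, hv2, hv3⟩ := chainU (-S) (by simpa using hS)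
  have hvS : ∀ l ≤ r, -v l ∈ S := fun l hl => by simpa using hv.mem l hl
  have huS : ∀ l ≤ m, u l ∈ S := fun l hl => hu.mem l hl
  have e0 : -v 0 = u m := by
    have h1 := hu.hi (-v 0) (hvS 0 (by omega))
    have h2 := hv.lo (-u m) (by simpa using huS m le_rfl)
    have := h1.eq_zero (by convert h2 using 1; abel)
    rw [sub_eq_zero] at this; exact this.symm
  have er : -v r = u 0 := by
    have h1 := hu.lo (-v r) (hvS r le_rfl)
    have h2 := hv.hi (-u 0) (by simpa using huS 0 (by omega))
    have := h1.eq_zero (by convert h2 using 1; abel)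
    rw [sub_eq_zero] at this; exact this
  have e0' : v 0 = - u m := by rw [← e0, neg_neg]
  have er' : v r = - u 0 := by rw [← er, neg_neg]
  have hnegset : convexHull ℝ ((-S : Finset (ℝ × ℝ)) : Set (ℝ × ℝ)) =
      {x | -x ∈ convexHull ℝ (S : Set (ℝ × ℝ))} := by
    rw [Finset.coe_neg, convexHull_neg]; rfl
  set w : ℕ → ℝ × ℝ := fun i => if i < m then u i else -v (i - m) with hw
  have hw1 : ∀ i ≤ m, w i = u i := by
    intro i hi
    rcases hi.eq_or_lt with rfl | hi
    · simp [hw, e0]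
    · simp [hw, hi]
  have hw2 : ∀ i, w (m + i) = -v i := by intro i; simp [hw]
  have hcl : w (m + r) = w 0 := by rw [hw2, hw1 0 (by omega), er]
  have hcyc : Cyc w m r (convexHull ℝ (S : Set (ℝ × ℝ))) := by
    refine ⟨hu.hull.congr hw1, ?_, hcl⟩
    rw [← hnegset]
    exact hv.hull.congr fun i _ => by rw [hw2, neg_neg]
  rcases Nat.eq_zero_or_pos (m + r) with h0 | hn
  · -- single point
    obtain ⟨rfl, rfl⟩ : m = 0 ∧ r = 0 := by omega
    have hSs : (S : Set (ℝ × ℝ)) = {u 0} := by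
      ext x
      simp only [Set.mem_singleton_iff]
      constructor
      · intro hx
        have h1 := hu.lo x hx
        have h2 := hu.hi x hx
        exact sub_eq_zero.1 (h1.eq_zero (by rwa [neg_sub]))
      · rintro rfl; exact huS 0 le_rfl
    have hb : (ptPolygon (u 0)).body = convexHull ℝ (S : Set (ℝ × ℝ)) := by
      rw [hSs]; simp [ClockPolygon.body, ptPolygon]
    refine ⟨ptPolygon (u 0), hb, fun i => huS 0 le_rfl, w, 0, 0, hb ▸ hcyc, ?_⟩
    intro Y hY
    simp [omegaPerim, ptPolygon, omegaLen_zero hY]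
  · set n := m + r with hndef
    have hstep : ∀ i, w ((i + 1) % n) = w (i % n + 1) := by
      intro i
      have hlt := Nat.mod_lt i hn
      rcases (Nat.succ_le_of_lt hlt).eq_or_lt with h | h
      · have : (i + 1) % n = 0 := by
          rw [Nat.add_mod]
          rcases Nat.lt_or_ge 1 n with h1 | h1
          · rw [Nat.mod_eq_of_lt h1]
            have : i % n + 1 = n := h
            rw [this, Nat.mod_self]
          · have : n = 1 := by omega
            rw [this]; omega
        rw [this]
        have h' : i % n + 1 = n := h
        rw [h', hcl]
      · have : (i + 1) % n = i % n + 1 := by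
          have h1 : 1 < n := by omega
          rw [Nat.add_mod, Nat.mod_eq_of_lt h1, Nat.mod_eq_of_lt h]
        rw [this]
    have hwS : ∀ i < n, w i ∈ S := by
      intro i hi
      simp only [hw]
      split_ifs with h
      · exact huS i h.le
      · exact hvS _ (by omega)
    have hrS : Set.range (fun i => w (i % n)) ⊆ S := by
      rintro _ ⟨i, rfl⟩
      exact hwS _ (Nat.mod_lt i hn)
    have hwr : ∀ i ≤ n, w i ∈ Set.range (fun i => w (i % n)) := by
      intro i hi
      rcases hi.eq_or_lt with h | h
      · exact ⟨0, by simp [h, hcl]⟩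
      · exact ⟨i, by simp [Nat.mod_eq_of_lt h]⟩
    have hright : ∀ i < n, ∀ x ∈ convexHull ℝ (S : Set (ℝ × ℝ)),
        det2 (w (i + 1) - w i) (x - w i) ≤ 0 := by
      intro i hi x hx
      rcases Nat.lt_or_ge i m with h | h
      · exact hcyc.up.right i h x hx
      · obtain ⟨l, rfl⟩ := Nat.exists_eq_add_of_le h
        have := hcyc.dn.right l (by omega) (-x) (by simpa using hx)
        rw [← det2_neg_neg] at this
        convert this using 2
        · simp only [add_assoc]; abel
        · abel
    have hinj : ∀ i j, i < j → j < n → w i ≠ w j := by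
      intro i j hij hj he
      rcases Nat.lt_or_ge j m with h | h
      · have := hcyc.up.lt hij h.le
        exact this.ne (by rw [he, sub_self])
      · obtain ⟨l, rfl⟩ := Nat.exists_eq_add_of_le h
        rcases Nat.lt_or_ge i m with hi | hi
        · rcases Nat.eq_zero_or_pos l with rfl | hl
          · exact (hcyc.up.lt hi le_rfl).ne (by rw [he]; simp)
          · rcases Nat.eq_zero_or_pos i with rfl | hi0
            · have := (hcyc.dn.lt (show l < r by omega) le_rfl).ne
              apply this
              rw [← hndef, hcl, he, sub_self]
            · have h1 := hu2 i hi0 hi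
              have h2 := hv2 l hl (by omega)
              rw [hw1 i hi.le, hw2] at he
              have : v l = - u i := by rw [he, neg_neg]
              rw [this, e0', er'] at h2
              have e : det2 (-u 0 - -u m) (-u i - -u m) = - det2 (u m - u 0) (u i - u 0) := by
                simp [det2]; ring
              linarith
        · obtain ⟨l', rfl⟩ := Nat.exists_eq_add_of_le hi
          have := (hcyc.dn.lt (show l' < l by omega) (by omega)).ne
          apply this
          rw [he, sub_self]
    let P : ClockPolygon :=
      { n := n
        npos := hn
        verts := fun i => w (i % n)
        periodic := fun i => by simp
        inj := by
          intro i j hi hj h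
          simp only [Nat.mod_eq_of_lt hi, Nat.mod_eq_of_lt hj] at h
          rcases lt_trichotomy i j with h' | h' | h'
          · exact absurd h (hinj i j h' hj)
          · exact h'
          · exact absurd h.symm (hinj j i h' hi)
        clockwise := by
          intro i q hq
          rw [hstep]
          exact hright _ (Nat.mod_lt i hn) q (convexHull_mono hrS hq) }
    have hb : P.body = convexHull ℝ (S : Set (ℝ × ℝ)) := by
      apply Set.Subset.antisymm
      · exact convexHull_mono hrS
      · apply convexHull_min _ (convex_convexHull ℝ _)
        intro s hs
        by_contra hcon
        have hfin : (Set.range P.verts).Finite := S.finite_toSet.subset hrS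
        obtain ⟨f, c, h1, h2⟩ := geometric_hahn_banach_closed_point (convex_convexHull ℝ _)
          (Set.Finite.isCompact_convexHull (𝕜 := ℝ) hfin).isClosed hcon
        obtain ⟨d, hd⟩ : ∃ d, ∀ x, f x = det2 d x := ⟨_, linear_eq_det f⟩
        have h1' : ∀ i ≤ n, det2 d (w i) < c := fun i hi => by
          rw [← hd]; exact h1 _ (subset_convexHull ℝ _ (hwr i hi))
        rw [hd] at h2
        by_cases hpos : Lpos d
        · obtain ⟨i, hi, hmax⟩ := hu3 d hpos
          have := hmax s hs
          have h3 := h1' i (by omega)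
          rw [hw1 i hi] at h3
          linarith
        · rw [not_Lpos] at hpos
          by_cases hz : -d = 0
          · have hz' : d = 0 := by rw [← neg_neg d, hz, neg_zero]
            have h3 := h1' 0 (by omega)
            rw [hz', det2_zero_left] at h2 h3
            linarith
          · obtain ⟨i, hi, hmax⟩ := hv3 (-d) (hpos.pos_of_ne hz)
            have := hmax (-s) (by simpa using hs)
            have h3 := h1' (m + i) (by omega)
            rw [hw2] at h3
            rw [det2_neg_neg, det2_neg_left, ← det2_neg_right] at this
            linarith
    refine ⟨P, hb, fun i => hwS _ (Nat.mod_lt i hn), w, m, r, hb ▸ hcyc, ?_⟩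
    intro Y hY
    refine Finset.sum_congr rfl fun i hi => ?_
    have hi' : i < n := Finset.mem_range.1 hi
    show omegaLen Y (w ((i + 1) % n) - w (i % n)) = _
    rw [hstep, Nat.mod_eq_of_lt hi']


lemma ClockPolygon.verts_add_mul (P : ClockPolygon) (i k : ℕ) :
    P.verts (i + k * P.n) = P.verts i := by
  induction k with
  | zero => simp
  | succ k ih => rw [add_mul, one_mul, ← add_assoc, P.periodic, ih]

lemma ClockPolygon.verts_mod (P : ClockPolygon) (i : ℕ) : P.verts (i % P.n) = P.verts i := by
  conv_rhs => rw [← Nat.mod_add_div i P.n, mul_comm]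
  rw [P.verts_add_mul]

lemma ClockPolygon.modEq (P : ClockPolygon) {i j : ℕ} (h : P.verts i = P.verts j) :
    i ≡ j [MOD P.n] := by
  rw [← P.verts_mod i, ← P.verts_mod j] at h
  exact P.inj _ _ (Nat.mod_lt _ P.npos) (Nat.mod_lt _ P.npos) h

lemma ClockPolygon.range_finite (P : ClockPolygon) : (Set.range P.verts).Finite := by
  refine ((Finset.range P.n).image P.verts).finite_toSet.subset ?_
  rintro _ ⟨i, rfl⟩
  simp only [Finset.coe_image, Set.mem_image, Finset.coe_range, Set.mem_Iio]
  exact ⟨i % P.n, Nat.mod_lt _ P.npos, P.verts_mod i⟩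

lemma ClockPolygon.isCompact (P : ClockPolygon) : IsCompact P.body :=
  Set.Finite.isCompact_convexHull (𝕜 := ℝ) P.range_finite

lemma ClockPolygon.mem_body (P : ClockPolygon) (i : ℕ) : P.verts i ∈ P.body :=
  subset_convexHull ℝ _ ⟨i, rfl⟩

lemma sum_shift (F : ℕ → ℝ) (n : ℕ) (hF : ∀ i, F (i + n) = F i) (a : ℕ) :
    ∑ i ∈ Finset.range n, F (a + i) = ∑ i ∈ Finset.range n, F i := by
  induction a with
  | zero => simp
  | succ a ih =>
    rw [← ih]
    have h1 := Finset.sum_range_succ (fun i => F (a + i)) n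
    have h2 := Finset.sum_range_succ' (fun i => F (a + i)) n
    rw [h1, hF a, add_zero] at h2
    have : ∑ i ∈ Finset.range n, F (a + 1 + i) = ∑ i ∈ Finset.range n, F (a + (i + 1)) :=
      Finset.sum_congr rfl fun i _ => by congr 1; ring
    rw [this]; linarith

lemma ClockPolygon.data (P : ClockPolygon) : ∃ (p : ℕ → ℝ × ℝ) (m : ℕ), m < P.n ∧
    p P.n = p 0 ∧ (∀ i j, i < P.n → j < P.n → p i = p j → i = j) ∧
    (∀ i, p i ∈ P.body) ∧ (∀ x ∈ P.body, Lnn (x - p 0)) ∧ (∀ x ∈ P.body, Lnn (p m - x)) ∧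
    (∀ i, ∀ x ∈ P.body, det2 (p (i + 1) - p i) (x - p i) ≤ 0) ∧
    (∀ Y, omegaPerim Y P = ∑ i ∈ Finset.range P.n, omegaLen Y (p (i + 1) - p i)) ∧
    (2 ≤ P.n → ∀ i, p (i + 1) ≠ p i) := by
  obtain ⟨i0, hi0, hmin⟩ := Finset.exists_min_image (Finset.range P.n) (fun i => toLex (P.verts i))
    ⟨0, by simpa using P.npos⟩
  simp only [Finset.mem_range] at hi0 hmin
  have hmin' : ∀ i, Lnn (P.verts i - P.verts i0) := by
    intro i
    rw [← toLex_le_iff, ← P.verts_mod i]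
    exact hmin _ (Nat.mod_lt _ P.npos)
  obtain ⟨m, hm, hmax⟩ := Finset.exists_max_image (Finset.range P.n)
    (fun i => toLex (P.verts (i0 + i))) ⟨0, by simpa using P.npos⟩
  simp only [Finset.mem_range] at hm hmax
  have hmax' : ∀ i, Lnn (P.verts (i0 + m) - P.verts i) := by
    intro i
    rw [← toLex_le_iff]
    -- find j with i0 + j ≡ i
    have hj : ∃ j < P.n, P.verts (i0 + j) = P.verts i := by
      refine ⟨(i + (P.n - i0)) % P.n, Nat.mod_lt _ P.npos, ?_⟩
      rw [← P.verts_mod, Nat.add_mod_mod, P.verts_mod]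
      have : i0 + (i + (P.n - i0)) = i + P.n := by omega
      rw [this, P.periodic]
    obtain ⟨j, hj, e⟩ := hj
    rw [← e]
    exact hmax j hj
  refine ⟨fun i => P.verts (i0 + i), m, hm, P.periodic i0, ?_, fun i => P.mem_body _, ?_, ?_, ?_,
    ?_, ?_⟩
  · intro i j hi hj h
    have := Nat.ModEq.add_left_cancel' _ (P.modEq h)
    exact Nat.ModEq.eq_of_lt_of_lt this hi hj
  · intro x hx
    refine convexHull_min (t := {x | Lnn (x - P.verts (i0 + 0))}) ?_ (convex_Lnn_sub _) hx
    rintro _ ⟨i, rfl⟩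
    exact hmin' i
  · intro x hx
    refine convexHull_min (t := {x | Lnn (P.verts (i0 + m) - x)}) ?_ (convex_Lnn_sub' _) hx
    rintro _ ⟨i, rfl⟩
    exact hmax' i
  · intro i x hx
    exact P.clockwise (i0 + i) x hx
  · intro Y
    have := sum_shift (fun i => omegaLen Y (P.verts (i + 1) - P.verts i)) P.n
      (fun i => by rw [P.periodic, add_right_comm, P.periodic]) i0
    exact this.symm
  · intro hn i h
    have h1 : i0 + i + 1 ≡ i0 + i + 0 [MOD P.n] := P.modEq h
    have := Nat.ModEq.add_left_cancel' _ h1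
    have := Nat.ModEq.eq_of_lt_of_lt this (by omega) (by omega)
    omega

lemma ClockPolygon.hasCyc_or (P : ClockPolygon) : HasCyc P ∨
    (2 ≤ P.n ∧ ∃ d : ℝ × ℝ, d ≠ 0 ∧ ∀ x ∈ P.body, ∀ y ∈ P.body, det2 d (x - y) = 0) := by
  obtain ⟨p, m, hm, hcl, hinj, hmem, hlo, hhi, hr, hper, hne⟩ := P.data
  by_cases hn : 2 ≤ P.n
  swap
  · left
    have hn1 : P.n = 1 := by have := P.npos; omega
    have hm0 : m = 0 := by omega
    subst hm0
    refine ⟨p, 0, 0, ⟨⟨by simp, fun i _ => hmem i, hlo, hhi, by simp⟩,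
      ⟨by simp, fun i _ => by simpa using hmem (0 + i), ?_, ?_, by simp⟩, rfl⟩, ?_⟩
    · intro x hx
      have := hhi (-x) hx
      convert this using 1
      simp; abel
    · intro x hx
      have := hlo (-x) hx
      convert this using 1
      simp; abel
    · intro Y hY
      have e1 : p 1 = p 0 := by rw [hn1] at hcl; exact hcl
      rw [hper, hn1]
      simp [e1, omegaLen_zero hY]
  by_cases hcol : ∃ d : ℝ × ℝ, d ≠ 0 ∧ ∀ x ∈ P.body, ∀ y ∈ P.body, det2 d (x - y) = 0
  · exact Or.inr ⟨hn, hcol⟩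
  left
  have turn : ∀ l, l + 1 < P.n → Lpos (p (l + 1) - p l) → Lpos (p (l + 1) - p (l + 2)) →
      l + 1 = m := by
    intro l hl ha hb
    refine hinj _ _ hl hm ?_
    suffices h : ∀ x ∈ P.body, Lnn (p (l + 1) - x) by
      have h1 := h (p m) (hmem m)
      have h2 := hhi (p (l + 1)) (hmem _)
      exact sub_eq_zero.1 (h1.eq_zero (by rwa [neg_sub]))
    set a := p (l + 1) - p l with hadef
    set b := p (l + 1) - p (l + 2) with hbdef
    have hay : ∀ x ∈ P.body, 0 ≤ det2 a (p (l + 1) - x) := by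
      intro x hx
      have := hr l x hx
      have e : p (l + 1) - x = a - (x - p l) := by rw [hadef]; abel
      rw [e, det2_sub_right, det2_self]; linarith
    have hby : ∀ x ∈ P.body, 0 ≤ det2 (p (l + 1) - x) b := by
      intro x hx
      have := hr (l + 1) x hx
      rw [det2_swap, ← det2_neg_left, neg_sub, ← neg_neg (p (l + 1 + 1) - p (l + 1)),
        det2_neg_right, neg_sub] at this
      linarith
    have pl : ∀ y, det2 a b • y = det2 y b • a + det2 a y • b := by
      intro y
      ext <;> simp [det2] <;> ring
    have hab := hay (p (l + 2)) (hmem _)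
    rcases hab.lt_or_eq with hab | hab
    · intro x hx
      have h1 : Lnn (det2 a b • (p (l + 1) - x)) := by
        rw [pl]
        exact (Lnn.smul (hby x hx) ha.nn).add (Lnn.smul (hay x hx) hb.nn)
      have h2 := Lnn.smul (inv_nonneg.2 hab.le) h1
      rwa [smul_smul, inv_mul_cancel₀ hab.ne', one_smul] at h2
    · exfalso
      apply hcol
      refine ⟨a, ha.ne, ?_⟩
      have hz : ∀ x ∈ P.body, det2 a (p (l + 1) - x) = 0 := by
        intro x hx
        by_contra h0
        have hpos := lt_of_le_of_ne (hay x hx) (Ne.symm h0)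
        have h1 := (hb.smul hpos).add_nn (Lnn.smul (hby x hx) ha.nn)
        have h2 := pl (p (l + 1) - x)
        rw [← hab, zero_smul] at h2
        rw [add_comm, ← h2] at h1
        exact not_Lpos_zero h1
      intro x hx y hy
      have h1 := hz x hx
      have h2 := hz y hy
      rw [det2_sub_right] at *
      linarith
  have posor : ∀ i, ¬ Lpos (p (i + 1) - p i) → Lpos (p i - p (i + 1)) := by
    intro i h
    rw [not_Lpos, neg_sub] at h
    exact h.pos_of_ne (sub_ne_zero.2 (hne hn i).symm)
  have hup : ∀ i, i < m → Lpos (p (i + 1) - p i) := by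
    intro i
    induction i with
    | zero =>
      intro _
      exact (hlo _ (hmem 1)).pos_of_ne (sub_ne_zero.2 (hne hn 0))
    | succ i ih =>
      intro hi
      by_contra hcon
      have := turn i (by omega) (ih (by omega)) (posor _ hcon)
      omega
  have hdn : ∀ k, m + k < P.n → Lpos (p (P.n - 1 - k) - p (P.n - 1 - k + 1)) := by
    intro k
    induction k with
    | zero =>
      intro _
      have e : P.n - 1 - 0 + 1 = P.n := by omega
      have := hne hn (P.n - 1 - 0)
      rw [e] at this ⊢
      rw [hcl] at this ⊢
      exact (hlo _ (hmem _)).pos_of_ne (sub_ne_zero.2 this.symm)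
    | succ k ih =>
      intro hk
      by_contra hcon
      have hcon' : Lpos (p (P.n - 1 - (k + 1) + 1) - p (P.n - 1 - (k + 1))) := by
        rw [not_Lpos, neg_sub] at hcon
        exact hcon.pos_of_ne (sub_ne_zero.2 (hne hn _))
      have h1 := ih (by omega)
      have e : P.n - 1 - k = P.n - 1 - (k + 1) + 1 := by omega
      rw [e] at h1
      have := turn (P.n - 1 - (k + 1)) (by omega) hcon' h1
      omega
  obtain ⟨r, hrn⟩ : ∃ r, P.n = m + r := ⟨P.n - m, by omega⟩
  refine ⟨p, m, r, ⟨⟨hup, fun i _ => hmem i, hlo, hhi, fun i _ => hr i⟩,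
    ⟨?_, fun i _ => by simpa using hmem (m + i), ?_, ?_, ?_⟩, ?_⟩, ?_⟩
  · intro i hi
    have := hdn (P.n - 1 - (m + i)) (by omega)
    have e : P.n - 1 - (P.n - 1 - (m + i)) = m + i := by omega
    rw [e] at this
    convert this using 1
    simp only [add_assoc]; abel
  · intro x hx
    have := hhi (-x) hx
    convert this using 1
    simp; abel
  · intro x hx
    have := hlo (-x) hx
    convert this using 1
    rw [← hrn, hcl]; abel
  · intro i hi x hx
    have := hr (m + i) (-x) hx
    rw [← det2_neg_neg] at this
    convert this using 2
    · simp only [add_assoc]; abel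
    · abel
  · rw [← hrn, hcl]
  · intro Y _
    rw [hper, hrn]

lemma det2_bdd {Y : Set (ℝ × ℝ)} (hY : IsCompact Y) (v : ℝ × ℝ) : BddAbove (det2 v '' Y) := by
  apply IsCompact.bddAbove
  apply hY.image
  unfold det2
  fun_prop

lemma le_omegaLen {Y : Set (ℝ × ℝ)} (hY : IsCompact Y) (v : ℝ × ℝ) {x : ℝ × ℝ} (hx : x ∈ Y) :
    det2 v x ≤ omegaLen Y v := le_csSup (det2_bdd hY v) ⟨x, hx, rfl⟩

lemma omegaLen_le {Y : Set (ℝ × ℝ)} (hY : Y.Nonempty) (v : ℝ × ℝ) {c : ℝ}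
    (h : ∀ x ∈ Y, det2 v x ≤ c) : omegaLen Y v ≤ c := by
  apply csSup_le (hY.image _)
  rintro _ ⟨x, hx, rfl⟩
  exact h x hx

lemma omegaLen_tri {Y : Set (ℝ × ℝ)} (hY : IsCompact Y) (hY' : Y.Nonempty) (g : ℕ → ℝ × ℝ)
    (k : ℕ) : omegaLen Y (g k - g 0) ≤ ∑ i ∈ Finset.range k, omegaLen Y (g (i + 1) - g i) := by
  apply omegaLen_le hY'
  intro x hx
  rw [← sum_det2_left]
  exact Finset.sum_le_sum fun i _ => le_omegaLen hY _ hx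

lemma perim_ge {q : ℕ → ℝ × ℝ} {m' r' : ℕ} {Y : Set (ℝ × ℝ)} (hq : Cyc q m' r' Y)
    (hY : IsCompact Y) (P : ClockPolygon) :
    ∑ j ∈ Finset.range (m' + r'), omegaLen P.body (q (j + 1) - q j) ≤ omegaPerim Y P := by
  have hY' : Y.Nonempty := ⟨_, hq.up.mem 0 (by omega)⟩
  rcases P.hasCyc_or with ⟨p, m, r, hc, hper⟩ | ⟨hn, d, hd, hcol⟩
  · rw [hper Y hY', hc.symm_len hq]
  · obtain ⟨p, m, hm, hcl, hinj, hmem, hlo, hhi, hr, hper, hne⟩ := P.data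
    have hab : Lpos (p m - p 0) := by
      refine (hlo _ (hmem m)).pos_of_ne fun h => ?_
      rw [sub_eq_zero] at h
      have h1 := hlo _ (hmem 1)
      have h2 := hhi _ (hmem 1)
      rw [h] at h2
      exact hne hn 0 (sub_eq_zero.1 (h1.eq_zero (by rwa [neg_sub])))
    have hz : ∀ x ∈ P.body, det2 (p m - p 0) (x - p 0) = 0 := by
      intro x hx
      have h1 := hcol _ (hmem m) _ (hmem 0)
      have h2 := hcol x hx _ (hmem 0)
      have pl : det2 (p m - p 0) (x - p 0) • d =
          det2 d (x - p 0) • (p m - p 0) - det2 d (p m - p 0) • (x - p 0) := by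
        ext <;> simp [det2] <;> ring
      rw [h1, h2, zero_smul, zero_smul, sub_zero] at pl
      exact (smul_eq_zero.1 pl).resolve_right hd
    set w : ℕ → ℝ × ℝ := fun i => if i = 1 then p m else p 0 with hw
    have w0 : w 0 = p 0 := by simp [hw]
    have w1 : w 1 = p m := by simp [hw]
    have w2 : w 2 = p 0 := by simp [hw]
    have hc : Cyc w 1 1 P.body := by
      refine ⟨⟨?_, ?_, ?_, ?_, ?_⟩, ⟨?_, ?_, ?_, ?_, ?_⟩, by rw [w0]; exact w2⟩
      · intro i hi
        obtain rfl : i = 0 := by omega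
        simpa [w0, w1] using hab
      · intro i _
        simp only [hw]; split_ifs
        · exact hmem m
        · exact hmem 0
      · rw [w0]; exact hlo
      · rw [w1]; exact hhi
      · intro i hi x hx
        obtain rfl : i = 0 := by omega
        rw [zero_add, w0, w1]
        exact (hz x hx).le
      · intro i hi
        obtain rfl : i = 0 := by omega
        show Lpos (-w 2 - -w 1)
        rw [w1, w2]
        convert hab using 1; abel
      · intro i _
        simp only [hw, Set.mem_ofPred_eq, neg_neg]; split_ifs
        · exact hmem m
        · exact hmem 0
      · intro x hx
        show Lnn (x - - w 1)
        rw [w1]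
        convert hhi (-x) hx using 1; abel
      · intro x hx
        show Lnn (- w 2 - x)
        rw [w2]
        convert hlo (-x) hx using 1; abel
      · intro i hi x hx
        obtain rfl : i = 0 := by omega
        show det2 (-w 2 - -w 1) (x - -w 1) ≤ 0
        rw [w1, w2]
        have h1 := hz (-x) hx
        have : det2 (-p 0 - -p m) (x - -p m) = - det2 (p m - p 0) (-x - p 0) := by
          simp [det2]; ring
        rw [this, h1, neg_zero]
    rw [hc.symm_len hq, hper Y]
    obtain ⟨r, hrn⟩ : ∃ r, P.n = m + r := ⟨P.n - m, by omega⟩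
    rw [hrn, Finset.sum_range_add _ m r]
    have e : ∑ j ∈ Finset.range (1 + 1), omegaLen Y (w (j + 1) - w j) =
        omegaLen Y (p m - p 0) + omegaLen Y (p 0 - p m) := by
      rw [Finset.sum_range_succ, Finset.sum_range_one]
      simp only [zero_add, Nat.reduceAdd, w0, w1, w2]
    rw [e]
    have t1 := omegaLen_tri hY hY' p m
    have t2 := omegaLen_tri hY hY' (fun i => p (m + i)) r
    simp only [add_zero, ← hrn, hcl] at t2
    exact add_le_add t1 t2


lemma ClockPolygon.body_nonempty (P : ClockPolygon) : P.body.Nonempty := ⟨_, P.mem_body 0⟩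

lemma perim_le_of_hasCyc {Q : ClockPolygon} (hQ : HasCyc Q) (P : ClockPolygon) :
    omegaPerim P.body Q ≤ omegaPerim Q.body P := by
  obtain ⟨q, m, r, hc, hper⟩ := hQ
  rw [hper _ P.body_nonempty]
  exact perim_ge hc Q.isCompact P

lemma perim_eq_of_hasCyc {Q P : ClockPolygon} (hQ : HasCyc Q) (hP : HasCyc P) :
    omegaPerim P.body Q = omegaPerim Q.body P :=
  le_antisymm (perim_le_of_hasCyc hQ P) (perim_le_of_hasCyc hP Q)

lemma sq_sum_zero {a b : ℝ} (h : a * a + b * b ≤ 0) : a = 0 ∧ b = 0 := by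
  have h1 := mul_self_nonneg a
  have h2 := mul_self_nonneg b
  exact ⟨mul_self_eq_zero.1 (by linarith), mul_self_eq_zero.1 (by linarith)⟩

lemma interior_noncol {X : Set (ℝ × ℝ)} (hX : (interior X).Nonempty) :
    ¬ ∃ d : ℝ × ℝ, d ≠ 0 ∧ ∀ x ∈ X, ∀ y ∈ X, det2 d (x - y) = 0 := by
  rintro ⟨d, hd, h⟩
  obtain ⟨x, hx⟩ := hX
  have hc : Filter.Tendsto (fun t : ℝ => x + t • ((-d.2, d.1) : ℝ × ℝ)) (nhds 0) (nhds x) := by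
    have : Continuous (fun t : ℝ => x + t • ((-d.2, d.1) : ℝ × ℝ)) := by fun_prop
    have := this.tendsto 0
    simpa using this
  have hev := hc.eventually (mem_interior_iff_mem_nhds.1 hx)
  obtain ⟨ε, hε, hball⟩ := Metric.eventually_nhds_iff.1 hev
  have h1 := hball (y := ε / 2) (by rw [Real.dist_eq, sub_zero, abs_of_pos] <;> linarith)
  have h2 := h _ h1 x (interior_subset hx)
  rw [add_sub_cancel_left, det2_smul_right] at h2
  have h3 : det2 d (-d.2, d.1) = 0 := (mul_eq_zero.1 h2).resolve_left (by linarith)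
  simp only [det2] at h3
  apply hd
  have h4 := sq_sum_zero (a := d.1) (b := d.2) (by linarith)
  exact Prod.ext h4.1 h4.2

def cedge (Q : ClockPolygon) (j : ℕ) : ℝ × ℝ := Q.verts (j + 1) - Q.verts j

lemma cedge_mod (Q : ClockPolygon) (j : ℕ) : cedge Q (j % Q.n) = cedge Q j := by
  unfold cedge
  rw [Q.verts_mod]
  congr 1
  rw [← Q.verts_mod, Nat.mod_add_mod, Q.verts_mod]

lemma sum_cedge (Q : ClockPolygon) (x : ℝ × ℝ) :
    ∑ j ∈ Finset.range Q.n, det2 (cedge Q j) x = 0 := by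
  have := sum_det2_left Q.verts x Q.n
  have h0 := Q.periodic 0
  rw [zero_add] at h0
  rw [h0, sub_self, det2_zero_left] at this
  exact this

lemma exists_nonparallel (Q : ClockPolygon)
    (hnc : ¬ ∃ d : ℝ × ℝ, d ≠ 0 ∧ ∀ x ∈ Q.body, ∀ y ∈ Q.body, det2 d (x - y) = 0) :
    ∃ j < Q.n, ∃ l < Q.n, det2 (cedge Q j) (cedge Q l) ≠ 0 := by
  by_contra hcon
  push Not at hcon
  have hd : ∃ d : ℝ × ℝ, d ≠ 0 ∧ ∀ l, l < Q.n → det2 d (cedge Q l) = 0 := by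
    by_cases h : ∃ j < Q.n, cedge Q j ≠ 0
    · obtain ⟨j, hj, h0⟩ := h
      exact ⟨_, h0, fun l hl => hcon j hj l hl⟩
    · push Not at h
      exact ⟨(1, 0), by simp, fun l hl => by rw [h l hl, det2_zero_right]⟩
  obtain ⟨d, hd0, hd⟩ := hd
  apply hnc
  refine ⟨d, hd0, ?_⟩
  have h1 : ∀ i, det2 d (Q.verts i) = det2 d (Q.verts 0) := by
    intro i
    induction i with
    | zero => rfl
    | succ i ih =>
      have := hd (i % Q.n) (Nat.mod_lt _ Q.npos)
      rw [cedge_mod, cedge, det2_sub_right] at this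
      linarith
  have h2 : ∀ x ∈ Q.body, det2 d x = det2 d (Q.verts 0) := by
    intro x hx
    apply le_antisymm
    · refine convexHull_min (t := {x | det2 d x ≤ det2 d (Q.verts 0)}) ?_ (convex_det_le _ _) hx
      rintro _ ⟨i, rfl⟩
      exact (h1 i).le
    · have : x ∈ {x | det2 (-d) x ≤ det2 (-d) (Q.verts 0)} := by
        refine convexHull_min (t := {x | det2 (-d) x ≤ det2 (-d) (Q.verts 0)}) ?_
          (convex_det_le _ _) hx
        rintro _ ⟨i, rfl⟩
        simp [det2_neg_left, h1 i]
      simp only [Set.mem_ofPred_eq, det2_neg_left] at this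
      linarith
  intro x hx y hy
  rw [det2_sub_right, h2 x hx, h2 y hy, sub_self]

lemma edge_ne {Q : ClockPolygon} (hn : 2 ≤ Q.n) (i : ℕ) : cedge Q i ≠ 0 := by
  intro h
  have h1 : i + 1 ≡ i + 0 [MOD Q.n] := Q.modEq (sub_eq_zero.1 h)
  have := Nat.ModEq.add_left_cancel' _ h1
  have := Nat.ModEq.eq_of_lt_of_lt this (by omega) (by omega)
  omega

def outerSet (Q : ClockPolygon) (H : ℕ → ℝ) : Set (ℝ × ℝ) :=
  {x | ∀ j, j < Q.n → det2 (cedge Q j) x ≤ H j}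

lemma mem_outerSet {Q : ClockPolygon} {H : ℕ → ℝ} {x : ℝ × ℝ} :
    x ∈ outerSet Q H ↔ ∀ j, j < Q.n → det2 (cedge Q j) x ≤ H j := Iff.rfl

lemma outer_perturb {Q : ClockPolygon} {H : ℕ → ℝ} {x w : ℝ × ℝ} (hx : x ∈ outerSet Q H)
    (h : ∀ j, j < Q.n → det2 (cedge Q j) x < H j ∨ det2 (cedge Q j) w = 0) :
    ∃ ε : ℝ, 0 < ε ∧ x + ε • w ∈ outerSet Q H ∧ x - ε • w ∈ outerSet Q H := by
  have hev : ∀ᶠ t : ℝ in nhds 0, ∀ j ∈ Finset.range Q.n, det2 (cedge Q j) (x + t • w) ≤ H j := by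
    rw [Filter.eventually_all_finset]
    intro j hj
    rw [Finset.mem_range] at hj
    rcases h j hj with h1 | h1
    · have hc : Continuous (fun t : ℝ => det2 (cedge Q j) (x + t • w)) := by
        unfold det2; fun_prop
      have := hc.tendsto 0
      rw [zero_smul, add_zero] at this
      filter_upwards [this.eventually (gt_mem_nhds h1)] with t ht using ht.le
    · filter_upwards with t
      rw [det2_add_right, det2_smul_right, h1, mul_zero, add_zero]
      exact hx j hj
  obtain ⟨ε, hε, hball⟩ := Metric.eventually_nhds_iff.1 hev
  refine ⟨ε / 2, by linarith, ?_, ?_⟩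
  · intro j hj
    exact hball (y := ε / 2) (by rw [Real.dist_eq, sub_zero, abs_of_pos] <;> linarith) j
      (Finset.mem_range.2 hj)
  · intro j hj
    have := hball (y := -(ε / 2))
      (by rw [Real.dist_eq, sub_zero, abs_neg, abs_of_pos] <;> linarith) j (Finset.mem_range.2 hj)
    rwa [neg_smul, ← sub_eq_add_neg] at this

lemma outer_closed (Q : ClockPolygon) (H : ℕ → ℝ) : IsClosed (outerSet Q H) := by
  have : outerSet Q H = ⋂ j, ⋂ (_ : j < Q.n), {x | det2 (cedge Q j) x ≤ H j} := by
    ext x; simp [mem_outerSet]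
  rw [this]
  refine isClosed_iInter fun j => isClosed_iInter fun _ => isClosed_le ?_ continuous_const
  unfold det2; fun_prop

lemma outer_convex (Q : ClockPolygon) (H : ℕ → ℝ) : Convex ℝ (outerSet Q H) := by
  have : outerSet Q H = ⋂ j, ⋂ (_ : j < Q.n), {x | det2 (cedge Q j) x ≤ H j} := by
    ext x; simp [mem_outerSet]
  rw [this]
  exact convex_iInter fun j => convex_iInter fun _ => convex_det_le _ _

lemma cramer {e f x : ℝ × ℝ} (h : det2 e f ≠ 0) :
    x = (det2 e f)⁻¹ • (det2 e x • f - det2 f x • e) := by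
  have : det2 e x • f - det2 f x • e = det2 e f • x := by
    ext <;> simp [det2] <;> ring
  rw [this, smul_smul, inv_mul_cancel₀ h, one_smul]

lemma outer_abs {Q : ClockPolygon} {H : ℕ → ℝ} {x : ℝ × ℝ} (hx : x ∈ outerSet Q H) {j : ℕ}
    (hj : j < Q.n) : |det2 (cedge Q j) x| ≤ ∑ l ∈ Finset.range Q.n, |H l| := by
  have hjm := Finset.mem_range.2 hj
  rw [abs_le]
  constructor
  · have h0 := sum_cedge Q x
    rw [← Finset.add_sum_erase _ _ hjm] at h0
    have h1 : ∑ l ∈ (Finset.range Q.n).erase j, det2 (cedge Q l) x ≤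
        ∑ l ∈ (Finset.range Q.n).erase j, |H l| :=
      Finset.sum_le_sum fun l hl =>
        (hx l (Finset.mem_range.1 (Finset.mem_of_mem_erase hl))).trans (le_abs_self _)
    have h2 : ∑ l ∈ (Finset.range Q.n).erase j, |H l| ≤ ∑ l ∈ Finset.range Q.n, |H l| :=
      Finset.sum_le_sum_of_subset_of_nonneg (Finset.erase_subset _ _)
        fun _ _ _ => abs_nonneg _
    linarith
  · refine (hx j hj).trans ((le_abs_self _).trans ?_)
    exact Finset.single_le_sum (f := fun l => |H l|) (fun _ _ => abs_nonneg _) hjm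

lemma outer_compact {Q : ClockPolygon} (H : ℕ → ℝ) {j l : ℕ} (hj : j < Q.n) (hl : l < Q.n)
    (hjl : det2 (cedge Q j) (cedge Q l) ≠ 0) : IsCompact (outerSet Q H) := by
  set M := ∑ l ∈ Finset.range Q.n, |H l|
  have hc : IsCompact ((fun s : ℝ × ℝ => (det2 (cedge Q j) (cedge Q l))⁻¹ •
      (s.1 • cedge Q l - s.2 • cedge Q j)) '' Set.Icc ((-M, -M) : ℝ × ℝ) (M, M)) := by
    apply isCompact_Icc.image
    fun_prop
  refine hc.of_isClosed_subset (outer_closed Q H) ?_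
  intro x hx
  refine ⟨(det2 (cedge Q j) x, det2 (cedge Q l) x), ?_, (cramer hjl).symm⟩
  have h1 := abs_le.1 (outer_abs hx hj)
  have h2 := abs_le.1 (outer_abs hx hl)
  exact ⟨⟨h1.1, h2.1⟩, ⟨h1.2, h2.2⟩⟩

lemma outer_extreme_finite {Q : ClockPolygon} (hn : 2 ≤ Q.n) (H : ℕ → ℝ) :
    ((outerSet Q H).extremePoints ℝ).Finite := by
  refine (((Finset.range Q.n) ×ˢ (Finset.range Q.n)).finite_toSet.image
    (fun a : ℕ × ℕ => (det2 (cedge Q a.1) (cedge Q a.2))⁻¹ •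
      (H a.1 • cedge Q a.2 - H a.2 • cedge Q a.1))).subset ?_
  intro x hx
  rw [mem_extremePoints] at hx
  obtain ⟨hxm, hxe⟩ := hx
  have hact : ∃ j < Q.n, ∃ l < Q.n, det2 (cedge Q j) x = H j ∧ det2 (cedge Q l) x = H l ∧
      det2 (cedge Q j) (cedge Q l) ≠ 0 := by
    by_contra hcon
    push Not at hcon
    have hw : ∃ w : ℝ × ℝ, w ≠ 0 ∧
        ∀ j, j < Q.n → det2 (cedge Q j) x < H j ∨ det2 (cedge Q j) w = 0 := by
      by_cases h : ∃ l < Q.n, det2 (cedge Q l) x = H l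
      · obtain ⟨l, hl, hla⟩ := h
        refine ⟨cedge Q l, edge_ne hn l, fun j hj => ?_⟩
        rcases (hxm j hj).lt_or_eq with h | h
        · exact Or.inl h
        · exact Or.inr (hcon j hj l hl h hla)
      · push Not at h
        exact ⟨(1, 0), by simp, fun j hj => Or.inl (lt_of_le_of_ne (hxm j hj) (h j hj))⟩
    obtain ⟨w, hw0, hw⟩ := hw
    obtain ⟨ε, hε, h1, h2⟩ := outer_perturb hxm hw
    have := (hxe _ h1 _ h2 ⟨1 / 2, 1 / 2, by norm_num, by norm_num, by norm_num, by
      ext <;> simp <;> ring⟩).1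
    rw [add_eq_left, smul_eq_zero] at this
    exact this.elim hε.ne' hw0
  obtain ⟨j, hj, l, hl, h1, h2, h3⟩ := hact
  refine ⟨(j, l), by simp [hj, hl], ?_⟩
  show _ • (H j • cedge Q l - H l • cedge Q j) = x
  rw [← h1, ← h2]
  exact (cramer h3).symm

lemma parallel_of_det {e f : ℝ × ℝ} (he : e ≠ 0) (hf : f ≠ 0) (h : det2 e f = 0) :
    ∃ t : ℝ, t ≠ 0 ∧ f = t • e := by
  have hs : e.1 * e.1 + e.2 * e.2 ≠ 0 := by
    intro h0
    apply he
    have h4 := sq_sum_zero (a := e.1) (b := e.2) (by linarith)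
    exact Prod.ext h4.1 h4.2
  have key : f = ((e.1 * f.1 + e.2 * f.2) / (e.1 * e.1 + e.2 * e.2)) • e := by
    simp only [det2] at h
    ext
    · simp only [Prod.smul_fst, smul_eq_mul]; rw [div_mul_eq_mul_div, eq_div_iff hs]; linear_combination (-e.2) * h
    · simp only [Prod.smul_snd, smul_eq_mul]; rw [div_mul_eq_mul_div, eq_div_iff hs]; linear_combination (e.1) * h
  refine ⟨_, ?_, key⟩
  intro h0
  rw [h0, zero_smul] at key
  exact hf key

lemma exists_parallel (Q : ClockPolygon)
    (hnc : ¬ ∃ d : ℝ × ℝ, d ≠ 0 ∧ ∀ x ∈ Q.body, ∀ y ∈ Q.body, det2 d (x - y) = 0)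
    (P : ClockPolygon) : ∃ R : ClockPolygon, EdgesParallel R Q ∧ P.body ⊆ R.body ∧
      omegaPerim Q.body R ≤ omegaPerim Q.body P := by
  have hQ : HasCyc Q := Q.hasCyc_or.resolve_right fun h => hnc h.2
  obtain ⟨j, hj, l, hl, hjl⟩ := exists_nonparallel Q hnc
  have hn : 2 ≤ Q.n := by
    by_contra hlt
    have h1 : j = 0 := by omega
    have h2 : l = 0 := by omega
    rw [h1, h2, det2_self] at hjl
    exact hjl rfl
  set H : ℕ → ℝ := fun j => omegaLen P.body (cedge Q j) with hH
  have hsub : P.body ⊆ outerSet Q H := fun x hx j _ => le_omegaLen P.isCompact _ hx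
  have hcomp := outer_compact H hj hl hjl
  have hfin := outer_extreme_finite hn H
  have hKM := closure_convexHull_extremePoints hcomp (outer_convex Q H)
  rw [(Set.Finite.isCompact_convexHull (𝕜 := ℝ) hfin).isClosed.closure_eq] at hKM
  have hne : hfin.toFinset.Nonempty := by
    rw [Set.Finite.toFinset_nonempty]
    by_contra hcon
    rw [Set.not_nonempty_iff_eq_empty] at hcon
    rw [hcon, convexHull_empty] at hKM
    have := hsub (P.mem_body 0)
    rw [← hKM] at this
    exact this
  obtain ⟨R, hRb, -, hRc⟩ := exists_polygon hfin.toFinset hne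
  rw [Set.Finite.coe_toFinset, hKM] at hRb
  refine ⟨R, ?_, hRb ▸ hsub, ?_⟩
  · intro i hi hf
    set f := R.verts (i + 1) - R.verts i with hfdef
    have ha : R.verts i ∈ outerSet Q H := hRb ▸ R.mem_body i
    have hb : R.verts (i + 1) ∈ outerSet Q H := hRb ▸ R.mem_body (i + 1)
    have hm : R.verts i + (1 / 2 : ℝ) • f ∈ outerSet Q H := by
      have := (outer_convex Q H) ha hb (show (0 : ℝ) ≤ 1 / 2 by norm_num)
        (show (0 : ℝ) ≤ 1 / 2 by norm_num) (by norm_num)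
      convert this using 1
      ext <;> simp [hfdef] <;> ring
    have hact : ∃ j < Q.n, det2 (cedge Q j) (R.verts i + (1 / 2 : ℝ) • f) = H j := by
      by_contra hcon
      push Not at hcon
      obtain ⟨ε, hε, h1, -⟩ := outer_perturb (w := (-f.2, f.1)) hm
        (fun j hj => Or.inl (lt_of_le_of_ne (hm j hj) (hcon j hj)))
      rw [← hRb] at h1
      have h2 := R.clockwise i _ h1
      rw [← hfdef, add_assoc, add_sub_cancel_left, det2_add_right, det2_smul_right,
        det2_smul_right, det2_self] at h2
      simp only [det2] at h2
      have h3 : f.1 * f.1 - f.2 * -f.2 ≤ 0 := by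
        by_contra h4
        push Not at h4
        have := mul_pos hε h4
        linarith
      apply hf
      have h4 := sq_sum_zero (a := f.1) (b := f.2) (by linarith)
      exact Prod.ext h4.1 h4.2
    obtain ⟨j, hj, hja⟩ := hact
    refine ⟨j, hj, parallel_of_det (edge_ne hn j) hf ?_⟩
    have h1 := ha j hj
    have h2 := hb j hj
    rw [det2_add_right, det2_smul_right] at hja
    have h3 : det2 (cedge Q j) f = det2 (cedge Q j) (R.verts (i + 1)) -
        det2 (cedge Q j) (R.verts i) := det2_sub_right _ _ _
    show det2 (cedge Q j) f = 0
    linarith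
  · rw [← perim_eq_of_hasCyc hQ hRc]
    refine le_trans ?_ (perim_le_of_hasCyc hQ P)
    refine Finset.sum_le_sum fun j hj => ?_
    refine omegaLen_le R.body_nonempty _ fun x hx => ?_
    rw [hRb] at hx
    exact hx j (Finset.mem_range.1 hj)

lemma lattice_finite {X : Set (ℝ × ℝ)} (hX : Bornology.IsBounded X) :
    {p ∈ X | IsLatticePt p}.Finite := by
  obtain ⟨R, hR⟩ := hX.exists_norm_le
  refine (((Set.finite_Icc (-⌈R⌉) ⌈R⌉).prod (Set.finite_Icc (-⌈R⌉) ⌈R⌉)).image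
    (fun z : ℤ × ℤ => ((z.1 : ℝ), (z.2 : ℝ)))).subset ?_
  rintro ⟨x, y⟩ ⟨hp, ⟨a, ha⟩, ⟨b, hb⟩⟩
  simp only at ha hb
  subst ha hb
  have h := hR _ hp
  rw [Prod.norm_def, max_le_iff, Real.norm_eq_abs, Real.norm_eq_abs, abs_le, abs_le] at h
  obtain ⟨⟨h1, h2⟩, h3, h4⟩ := h
  simp only at h1 h2 h3 h4
  have hc := Int.le_ceil R
  refine ⟨(a, b), ⟨⟨?_, ?_⟩, ⟨?_, ?_⟩⟩, rfl⟩
  · have : (-(⌈R⌉ : ℝ)) ≤ a := by linarith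
    exact_mod_cast this
  · have : (a : ℝ) ≤ ⌈R⌉ := by linarith
    exact_mod_cast this
  · have : (-(⌈R⌉ : ℝ)) ≤ b := by linarith
    exact_mod_cast this
  · have : (b : ℝ) ≤ ⌈R⌉ := by linarith
    exact_mod_cast this


def GoodSet (D : Finset (ℝ × ℝ)) : Prop :=
  (∀ z ∈ D, IsLatticePt z ∧ 0 ≤ z.1 ∧ 0 ≤ z.2) ∧
  (∀ z ∈ D, ∀ w, IsLatticePt w → 0 ≤ w.1 → 0 ≤ w.2 → w.1 ≤ z.1 → w.2 ≤ z.2 → w ∈ D) ∧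
  (∀ z ∈ convexHull ℝ (D : Set (ℝ × ℝ)), IsLatticePt z → z ∈ D)

lemma convex_Lpos_sub (b : ℝ × ℝ) : Convex ℝ {x | Lpos (b - x)} := by
  intro x hx y hy s t hs ht hst
  have h : b - (s • x + t • y) = s • (b - x) + t • (b - y) := by
    have : b = s • b + t • b := by rw [← add_smul, hst, one_smul]
    rw [smul_sub, smul_sub]
    nth_rewrite 1 [this]
    abel
  show Lpos (b - (s • x + t • y))
  rw [h]
  rcases hs.eq_or_lt with h0 | h0
  · have h1 : t = 1 := by linarith
    rw [← h0, h1, zero_smul, zero_add, one_smul]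
    exact hy
  · exact (Lpos.smul h0 hx).add_nn (Lnn.smul ht (Lpos.nn hy))

lemma GoodSet.erase {D : Finset (ℝ × ℝ)} (hD : GoodSet D) {b : ℝ × ℝ}
    (hb : ∀ x ∈ D, Lnn (b - x)) : GoodSet (D.erase b) := by
  obtain ⟨h1, h2, h3⟩ := hD
  refine ⟨fun z hz => h1 z (Finset.mem_of_mem_erase hz), ?_, ?_⟩
  · intro z hz w hw w1 w2 w3 w4
    rw [Finset.mem_erase] at hz ⊢
    refine ⟨?_, h2 z hz.2 w hw w1 w2 w3 w4⟩
    rintro rfl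
    apply hz.1
    have := hb z hz.2
    unfold Lnn at this
    simp only [Prod.fst_sub, Prod.snd_sub] at this
    rcases this with h | ⟨h, h'⟩
    · linarith
    · exact Prod.ext (by linarith) (by linarith)
  · intro z hz hl
    rw [Finset.mem_erase]
    refine ⟨?_, h3 z (convexHull_mono (by simp) hz) hl⟩
    have hsub : convexHull ℝ ((D.erase b : Finset (ℝ × ℝ)) : Set (ℝ × ℝ)) ⊆ {x | Lpos (b - x)} := by
      apply convexHull_min _ (convex_Lpos_sub b)
      intro x hx
      have hx' := Finset.mem_erase.1 (Finset.mem_coe.1 hx)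
      exact (hb x hx'.2).pos_of_ne (sub_ne_zero.2 (Ne.symm hx'.1))
    rintro rfl
    have := hsub hz
    exact (Lpos.ne this) (sub_self _)

lemma GoodSet.shrink (k : ℕ) : ∀ (n : ℕ) (D : Finset (ℝ × ℝ)), GoodSet D → D.card = k + 1 + n →
    ∃ D0 ⊆ D, GoodSet D0 ∧ D0.card = k + 1 := by
  intro n
  induction n with
  | zero => exact fun D h1 h2 => ⟨D, subset_rfl, h1, h2⟩
  | succ n ih =>
    intro D h1 h2
    obtain ⟨b, hb, hmax⟩ := exists_lex_max D (Finset.card_pos.1 (by omega))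
    obtain ⟨D0, hs, hg⟩ := ih (D.erase b) (h1.erase hmax)
      (by rw [Finset.card_erase_of_mem hb]; omega)
    exact ⟨D0, hs.trans (Finset.erase_subset _ _), hg⟩

lemma hseg {C : Set (ℝ × ℝ)} (hC : Convex ℝ C) {x y q : ℝ} (h0 : (0, y) ∈ C) (h1 : (q, y) ∈ C)
    (hx : 0 ≤ x) (hxq : x ≤ q) : (x, y) ∈ C := by
  rcases (hx.trans hxq).eq_or_lt with h | h
  · have : x = 0 := by linarith
    rw [this]; exact h0
  · have := hC h0 h1 (a := 1 - x / q) (b := x / q)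
      (by rw [sub_nonneg, div_le_one h]; exact hxq) (by positivity) (by ring)
    convert this using 1
    ext
    · simp; field_simp
    · simp; ring

lemma vseg {C : Set (ℝ × ℝ)} (hC : Convex ℝ C) {x y q : ℝ} (h0 : (x, 0) ∈ C) (h1 : (x, q) ∈ C)
    (hy : 0 ≤ y) (hyq : y ≤ q) : (x, y) ∈ C := by
  rcases (hy.trans hyq).eq_or_lt with h | h
  · have : y = 0 := by linarith
    rw [this]; exact h0
  · have := hC h0 h1 (a := 1 - y / q) (b := y / q)
      (by rw [sub_nonneg, div_le_one h]; exact hyq) (by positivity) (by ring)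
    convert this using 1
    ext
    · simp; ring
    · simp; field_simp

lemma lattice_zero_left {z : ℝ × ℝ} (h : IsLatticePt z) : IsLatticePt (0, z.2) :=
  ⟨⟨0, by simp⟩, h.2⟩
lemma lattice_zero_right {z : ℝ × ℝ} (h : IsLatticePt z) : IsLatticePt (z.1, 0) :=
  ⟨h.1, ⟨0, by simp⟩⟩

lemma GoodSet.proj1 {D : Finset (ℝ × ℝ)} (hD : GoodSet D) {q : ℝ × ℝ}
    (hq : q ∈ convexHull ℝ (D : Set (ℝ × ℝ))) : (q.1, 0) ∈ convexHull ℝ (D : Set (ℝ × ℝ)) := by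
  have hsub : convexHull ℝ (D : Set (ℝ × ℝ)) ⊆
      {q | ((q.1, 0) : ℝ × ℝ) ∈ convexHull ℝ (D : Set (ℝ × ℝ))} := by
    apply convexHull_min
    · intro z hz
      have h := hD.1 z hz
      exact subset_convexHull ℝ _ (hD.2.1 z hz (z.1, 0) (lattice_zero_right h.1) h.2.1 le_rfl
        le_rfl h.2.2)
    · intro x hx y hy s t hs ht hst
      have := convex_convexHull ℝ (D : Set (ℝ × ℝ)) hx hy hs ht hst
      simpa using this
  exact hsub hq

lemma GoodSet.proj2 {D : Finset (ℝ × ℝ)} (hD : GoodSet D) {q : ℝ × ℝ}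
    (hq : q ∈ convexHull ℝ (D : Set (ℝ × ℝ))) : (0, q.2) ∈ convexHull ℝ (D : Set (ℝ × ℝ)) := by
  have hsub : convexHull ℝ (D : Set (ℝ × ℝ)) ⊆
      {q | ((0, q.2) : ℝ × ℝ) ∈ convexHull ℝ (D : Set (ℝ × ℝ))} := by
    apply convexHull_min
    · intro z hz
      have h := hD.1 z hz
      exact subset_convexHull ℝ _ (hD.2.1 z hz (0, z.2) (lattice_zero_left h.1) le_rfl h.2.2
        h.2.1 le_rfl)
    · intro x hx y hy s t hs ht hst
      have := convex_convexHull ℝ (D : Set (ℝ × ℝ)) hx hy hs ht hst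
      simpa using this
  exact hsub hq

lemma GoodSet.polygon {D : Finset (ℝ × ℝ)} (hD : GoodSet D) (hne : D.Nonempty) :
    ∃ P : ClockPolygon, IsCompetitor P ∧ latticeCount P.body = D.card ∧ HasCyc P ∧
      P.body = convexHull ℝ (D : Set (ℝ × ℝ)) := by
  obtain ⟨P, hb, hv, hc⟩ := exists_polygon D hne
  refine ⟨P, ⟨fun i => (hD.1 _ (hv i)).1, fun i => (hD.1 _ (hv i)).2, ?_, ?_⟩, ?_, hc, hb⟩
  · rw [hb]
    obtain ⟨z, hz⟩ := hne
    exact hD.proj2 (hD.proj1 (subset_convexHull ℝ _ hz))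
  · rw [hb]
    rintro q hq ⟨x, y⟩ ⟨⟨hx1, hx2⟩, hy1, hy2⟩
    have hC := convex_convexHull ℝ (D : Set (ℝ × ℝ))
    have h1 : (x, q.2) ∈ convexHull ℝ (D : Set (ℝ × ℝ)) := hseg hC (hD.proj2 hq) hq hx1 hx2
    exact vseg hC (hD.proj1 h1) h1 hy1 hy2
  · rw [hb, latticeCount]
    have : {p ∈ convexHull ℝ (D : Set (ℝ × ℝ)) | IsLatticePt p} = (D : Set (ℝ × ℝ)) := by
      ext z
      exact ⟨fun h => hD.2.2 z h.1 h.2, fun h => ⟨subset_convexHull ℝ _ h, (hD.1 z h).1⟩⟩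
    rw [this, Set.ncard_coe_finset]

lemma edge_cases (Ω : ConvexDomain) (j : ℕ) :
    (0 ≤ (cedge Ω.P j).1 ∧ (cedge Ω.P j).2 ≤ 0) ∨
    ((cedge Ω.P j).1 = 0 ∧ 0 ≤ (cedge Ω.P j).2) ∨
    ((cedge Ω.P j).1 ≤ 0 ∧ (cedge Ω.P j).2 = 0) := by
  have hp := Ω.P.mem_body j
  have hq := Ω.P.mem_body (j + 1)
  have hcl := Ω.P.clockwise j
  set p := Ω.P.verts j with hpd
  set q := Ω.P.verts (j + 1) with hqd
  have he : cedge Ω.P j = q - p := rfl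
  rw [he]
  have np := Ω.nonneg p hp
  have nq := Ω.nonneg q hq
  simp only [Prod.fst_sub, Prod.snd_sub]
  have a1 := hcl (0, p.2) (Ω.rect p hp ⟨⟨le_rfl, np.1⟩, np.2, le_rfl⟩)
  have a2 := hcl (0, q.2) (Ω.rect q hq ⟨⟨le_rfl, nq.1⟩, nq.2, le_rfl⟩)
  have b1 := hcl (p.1, 0) (Ω.rect p hp ⟨⟨np.1, le_rfl⟩, le_rfl, np.2⟩)
  have b2 := hcl (q.1, 0) (Ω.rect q hq ⟨⟨nq.1, le_rfl⟩, le_rfl, nq.2⟩)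
  simp only [det2, Prod.fst_sub, Prod.snd_sub] at a1 a2 b1 b2
  by_cases h2 : 0 < q.2 - p.2
  · right; left
    have hp0 : p.1 = 0 := by nlinarith
    have hq0 : q.1 = 0 := by
      have : (q.2 - p.2) * q.1 ≤ 0 := by nlinarith
      nlinarith
    exact ⟨by linarith, h2.le⟩
  · by_cases h1 : q.1 - p.1 < 0
    · right; right
      have hp0 : q.2 = 0 := by
        have : (p.1 - q.1) * q.2 ≤ 0 := by nlinarith
        nlinarith
      have hq0 : p.2 = 0 := by
        have : (p.1 - q.1) * p.2 ≤ 0 := by nlinarith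
        nlinarith
      exact ⟨h1.le, by linarith⟩
    · left; exact ⟨by linarith, by linarith⟩

lemma exists_competitor (Ω : ConvexDomain) (k : ℕ) (Ξ : ClockPolygon)
    (hk : k + 1 ≤ latticeCount Ξ.body) : ∃ P : ClockPolygon, IsCompetitor P ∧
      latticeCount P.body = k + 1 ∧ omegaPerim Ω.P.body P ≤ omegaPerim Ω.P.body Ξ := by
  have hΩ : HasCyc Ω.P := Ω.P.hasCyc_or.resolve_right fun h => interior_noncol Ω.int_nonempty h.2
  have hTf := lattice_finite Ξ.isCompact.isBounded
  have hTne : {p ∈ Ξ.body | IsLatticePt p}.Nonempty := by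
    rw [← Set.ncard_pos hTf]; unfold latticeCount at hk; omega
  obtain ⟨ta, hta, hamin⟩ := hTf.exists_minimalFor (fun z => z.1) _ hTne
  obtain ⟨tb, htb, hbmin⟩ := hTf.exists_minimalFor (fun z => z.2) _ hTne
  have hamin' : ∀ t ∈ Ξ.body, IsLatticePt t → ta.1 ≤ t.1 := fun t h1 h2 => by
    rcases le_total ta.1 t.1 with h | h
    · exact h
    · exact hamin ⟨h1, h2⟩ h
  have hbmin' : ∀ t ∈ Ξ.body, IsLatticePt t → tb.2 ≤ t.2 := fun t h1 h2 => by
    rcases le_total tb.2 t.2 with h | h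
    · exact h
    · exact hbmin ⟨h1, h2⟩ h
  set c : ℝ × ℝ := (ta.1, tb.2) with hc
  set K : Set (ℝ × ℝ) := {z | 0 ≤ z.1 ∧ 0 ≤ z.2 ∧
    ∃ t ∈ Ξ.body, z.1 ≤ t.1 - c.1 ∧ z.2 ≤ t.2 - c.2} with hK
  have hKconv : Convex ℝ K := by
    rintro x ⟨hx1, hx2, t, ht, hx3, hx4⟩ y ⟨hy1, hy2, u, hu, hy3, hy4⟩ a b ha hb hab
    refine ⟨?_, ?_, a • t + b • u, convex_convexHull ℝ _ ht hu ha hb hab, ?_, ?_⟩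
    · simp only [Prod.fst_add, Prod.smul_fst, smul_eq_mul]; positivity
    · simp only [Prod.snd_add, Prod.smul_snd, smul_eq_mul]; positivity
    · simp only [Prod.fst_add, Prod.smul_fst, smul_eq_mul]
      have := mul_le_mul_of_nonneg_left hx3 ha
      have := mul_le_mul_of_nonneg_left hy3 hb
      have : a * c.1 + b * c.1 = c.1 := by rw [← add_mul, hab, one_mul]
      linarith
    · simp only [Prod.snd_add, Prod.smul_snd, smul_eq_mul]
      have := mul_le_mul_of_nonneg_left hx4 ha
      have := mul_le_mul_of_nonneg_left hy4 hb
      have : a * c.2 + b * c.2 = c.2 := by rw [← add_mul, hab, one_mul]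
      linarith
  have hKb : Bornology.IsBounded K := by
    obtain ⟨R, hR⟩ := Ξ.isCompact.isBounded.exists_norm_le
    refine (Metric.isBounded_Icc (0 : ℝ × ℝ) (R - c.1, R - c.2)).subset ?_
    rintro z ⟨h1, h2, t, ht, h3, h4⟩
    have h := hR t ht
    rw [Prod.norm_def, max_le_iff, Real.norm_eq_abs, Real.norm_eq_abs, abs_le, abs_le] at h
    exact ⟨⟨h1, h2⟩, ⟨by simp only; linarith, by simp only; linarith⟩⟩
  have hDf := lattice_finite hKb
  have hcard : {p ∈ Ξ.body | IsLatticePt p}.ncard ≤ {p ∈ K | IsLatticePt p}.ncard := by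
    refine Set.ncard_le_ncard_of_injOn (fun z => z - c) ?_ (fun x _ y _ h => sub_left_injective h)
      hDf
    rintro z ⟨hz, hzl⟩
    have h1 := hamin' z hz hzl
    have h2 := hbmin' z hz hzl
    refine ⟨⟨by simp [hc]; exact h1, by simp [hc]; exact h2, z, hz, by simp, by simp⟩, ?_⟩
    obtain ⟨⟨m, hm⟩, m', hm'⟩ := hzl
    obtain ⟨n, hn⟩ := hta.2.1
    obtain ⟨n', hn'⟩ := htb.2.2
    exact ⟨⟨m - n, by simp [hc, hm, hn]⟩, ⟨m' - n', by simp [hc, hm', hn']⟩⟩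
  have hgood : GoodSet hDf.toFinset := by
    refine ⟨?_, ?_, ?_⟩
    · intro z hz
      rw [Set.Finite.mem_toFinset] at hz
      exact ⟨hz.2, hz.1.1, hz.1.2.1⟩
    · intro z hz w hw h1 h2 h3 h4
      rw [Set.Finite.mem_toFinset] at hz ⊢
      obtain ⟨⟨_, _, t, ht, h5, h6⟩, _⟩ := hz
      exact ⟨⟨h1, h2, t, ht, h3.trans h5, h4.trans h6⟩, hw⟩
    · intro z hz hl
      rw [Set.Finite.mem_toFinset]
      rw [Set.Finite.coe_toFinset] at hz
      exact ⟨convexHull_min (fun x hx => hx.1) hKconv hz, hl⟩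
  have hcard' : k + 1 ≤ hDf.toFinset.card := by
    rw [← Set.ncard_eq_toFinset_card _ hDf]
    exact hk.trans hcard
  obtain ⟨D0, hsub, hg0, hc0⟩ := hgood.shrink k (hDf.toFinset.card - (k + 1)) _ (by omega)
  obtain ⟨P, hP1, hP2, hP3, hP4⟩ := hg0.polygon (Finset.card_pos.1 (by omega))
  refine ⟨P, hP1, hP2.trans hc0, ?_⟩
  rw [← perim_eq_of_hasCyc hΩ hP3]
  refine le_trans ?_ (perim_le_of_hasCyc hΩ Ξ)
  have hPK : P.body ⊆ K := by
    rw [hP4]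
    refine convexHull_min (fun x hx => ?_) hKconv
    exact ((Set.Finite.mem_toFinset hDf).1 (hsub hx)).1
  have key : ∀ j, omegaLen P.body (cedge Ω.P j) ≤
      omegaLen Ξ.body (cedge Ω.P j) - det2 (cedge Ω.P j) c := by
    intro j
    refine omegaLen_le P.body_nonempty _ fun z hz => ?_
    obtain ⟨h1, h2, t, ht, h3, h4⟩ := hPK hz
    have l1 := le_omegaLen Ξ.isCompact (cedge Ω.P j) ht
    have l2 := le_omegaLen Ξ.isCompact (cedge Ω.P j) hta.1
    have l3 := le_omegaLen Ξ.isCompact (cedge Ω.P j) htb.1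
    set e := cedge Ω.P j
    rcases edge_cases Ω j with ⟨g1, g2⟩ | ⟨g1, g2⟩ | ⟨g1, g2⟩
    · have m1 := mul_le_mul_of_nonneg_left h4 g1
      have m2 := mul_le_mul_of_nonpos_left h3 g2
      simp only [det2] at l1 ⊢
      linarith
    · have m1 := mul_nonneg g2 h1
      have g1' : e.1 = 0 := g1
      have m1' : 0 ≤ e.2 * z.1 := m1
      simp only [det2, g1', hc] at l2 ⊢
      linarith
    · have m1 := mul_nonpos_of_nonpos_of_nonneg g1 h2
      have g2' : e.2 = 0 := g2
      have m1' : e.1 * z.2 ≤ 0 := m1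
      simp only [det2, g2', hc] at l3 ⊢
      linarith
  have hs := Finset.sum_le_sum (s := Finset.range Ω.P.n) fun j _ => key j
  rw [Finset.sum_sub_distrib, sum_cedge, sub_zero] at hs
  exact hs

lemma omegaPerim_nonneg (Ω : ConvexDomain) (P : ClockPolygon) : 0 ≤ omegaPerim Ω.P.body P := by
  refine Finset.sum_nonneg fun i _ => ?_
  have := le_omegaLen Ω.P.isCompact (P.verts (i + 1) - P.verts i) Ω.zero_mem
  have h0 : det2 (P.verts (i + 1) - P.verts i) (0, 0) = 0 := det2_zero_right _
  linarith

lemma sInf_eq_of_mutual {A B : Set ℝ} (hA : ∀ r ∈ A, ∃ r' ∈ B, r' ≤ r)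
    (hB : ∀ r ∈ B, ∃ r' ∈ A, r' ≤ r) (hA0 : ∀ r ∈ A, 0 ≤ r) (hB0 : ∀ r ∈ B, 0 ≤ r) :
    sInf A = sInf B := by
  rcases A.eq_empty_or_nonempty with h | h
  · have : B = ∅ := by
      rw [Set.eq_empty_iff_forall_notMem]
      intro r hr
      obtain ⟨r', hr', _⟩ := hB r hr
      rw [h] at hr'
      exact hr'
    rw [h, this]
  · obtain ⟨r, hr⟩ := h
    obtain ⟨r', hr', _⟩ := hA r hr
    apply le_antisymm
    · refine le_csInf ⟨r', hr'⟩ fun b hb => ?_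
      obtain ⟨a, ha, hab⟩ := hB b hb
      exact (csInf_le ⟨0, fun x hx => hA0 x hx⟩ ha).trans hab
    · refine le_csInf ⟨r, hr⟩ fun b hb => ?_
      obtain ⟨a, ha, hab⟩ := hA b hb
      exact (csInf_le ⟨0, fun x hx => hB0 x hx⟩ ha).trans hab

/-- For a rational convex domain `Ω`, the capacity
`c_k(X_Ω)` (a minimum over competitor convex lattice domains with exactly
`k+1` lattice points) equals the infimum of `ℓ_Ω(∂Ξ)` over all (possibly
degenerate) compact convex polygons `Ξ` whose edges are parallel to edges of
`Ω` and which contain at least `k+1` lattice points. -/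
theorem echCap_eq_inf_parallel (Ω : ConvexDomain) (hrat : Ω.IsRational) (k : ℕ) :
    echCap Ω.body k =
      sInf { r | ∃ Ξ : ClockPolygon, EdgesParallel Ξ Ω.P ∧
        k + 1 ≤ latticeCount Ξ.body ∧ omegaPerim Ω.body Ξ = r } := by
  unfold echCap
  apply sInf_eq_of_mutual
  · rintro r ⟨P, hP, hl, rfl⟩
    obtain ⟨R, h1, h2, h3⟩ := exists_parallel Ω.P (interior_noncol Ω.int_nonempty) P
    refine ⟨_, ⟨R, h1, ?_, rfl⟩, h3⟩
    rw [← hl]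
    exact Set.ncard_le_ncard (fun x hx => ⟨h2 hx.1, hx.2⟩) (lattice_finite R.isCompact.isBounded)
  · rintro r ⟨Ξ, -, hl, rfl⟩
    obtain ⟨P, h1, h2, h3⟩ := exists_competitor Ω k Ξ hl
    exact ⟨_, ⟨P, h1, h2, rfl⟩, h3⟩
  · rintro r ⟨P, _, _, rfl⟩
    exact omegaPerim_nonneg Ω P
  · rintro r ⟨P, _, _, rfl⟩
    exact omegaPerim_nonneg Ω P


end
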